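/- arXiv:2408.02493 — 12 statements merged into one kernel-verified Lean document; each statement's English description precedes it below -/
import Mathlib

section
/- Let q = p^m be a prime power and let f(t) = t^4 + a t^3 + b t^2 + a q t + q^2 in Z[t] satisfy one of the following: (a) b = a^2 - q, b < 0, and every prime divisor of b is congruent to 1 mod 3; or (b) a = 0 and one of: b = 1 - 2q; b = 2 - 2q and p > 2; b = -q and (p ≡ 11 mod 12 and q is a square, or p = 3 and q is a square, or p = 2 and q is not a square); q = 2 and b = -4; q = 3 and b = -6. Assume moreover that f is either irreducible over Q or the square of a monic quadratic polynomial in Q[t]. Then either f(t) = (t^2 - q)^2 with q ∈ {2, 3}, or f(t) is irreducible over Q. -/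
open Polynomial NumberField

/-- The Weil polynomial `t^4 + a t^3 + b t^2 + a q t + q^2` over `ℤ`. -/
noncomputable def weilPoly (q : ℕ) (a b : ℤ) : Polynomial ℤ :=
  X ^ 4 + C a * X ^ 3 + C b * X ^ 2 + C (a * q) * X + C ((q : ℤ) ^ 2)

/-- Condition (a): `b = a^2 - q`, `b < 0`, every prime divisor of `b` is `≡ 1 mod 3`. -/
def PAcond (q : ℕ) (a b : ℤ) : Prop :=
  b = a ^ 2 - q ∧ b < 0 ∧ ∀ ℓ : ℕ, ℓ.Prime → (ℓ : ℤ) ∣ b → ℓ % 3 = 1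

/-- Condition (b) on the middle coefficient `b` (for `a = 0`), where `q = p^m`. -/
def PBcond (q p : ℕ) (b : ℤ) : Prop :=
  b = 1 - 2 * q ∨ (b = 2 - 2 * q ∧ 2 < p) ∨
    (b = -(q : ℤ) ∧ ((p % 12 = 11 ∧ IsSquare q) ∨ (p = 3 ∧ IsSquare q) ∨
      (p = 2 ∧ ¬ IsSquare q))) ∨
    (q = 2 ∧ b = -4) ∨ (q = 3 ∧ b = -6)

/-- `f ∈ P_A`: Weil polynomial, irreducible over `ℚ`, satisfying condition (a). -/
noncomputable def inPA (q p m : ℕ) (a b : ℤ) : Prop :=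
  p.Prime ∧ q = p ^ m ∧ 0 < m ∧
    Irreducible ((weilPoly q a b).map (Int.castRingHom ℚ)) ∧ PAcond q a b

/-- `f ∈ P_B`: Weil polynomial `t^4 + b t^2 + q^2`, irreducible over `ℚ`,
satisfying condition (b). -/
noncomputable def inPB (q p m : ℕ) (b : ℤ) : Prop :=
  p.Prime ∧ q = p ^ m ∧ 0 < m ∧
    Irreducible ((weilPoly q 0 b).map (Int.castRingHom ℚ)) ∧ PBcond q p b

/-- If the Weil polynomial is the square of a monic quadratic over `ℚ`, then its middle
coefficient is determined by `a` and `q`. -/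
theorem middle_coeff_of_weilPoly_eq_sq {q : ℕ} {a b : ℤ} {g : Polynomial ℚ} (hg : g.Monic)
    (hdeg : g.degree = 2) (h : (weilPoly q a b).map (Int.castRingHom ℚ) = g ^ 2) :
    4 * b = a ^ 2 + 8 * q ∨ (a * q = 0 ∧ 4 * b = a ^ 2 - 8 * q) := by
  have hnat : g.natDegree = 2 := natDegree_eq_of_degree_eq_some hdeg
  obtain ⟨c, d, hcd⟩ : ∃ c d : ℚ, g = X ^ 2 + C c * X + C d := by
    refine ⟨g.coeff 1, g.coeff 0, ?_⟩
    have h2 : g.coeff 2 = 1 := by simpa [hnat] using hg.coeff_natDegree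
    conv_lhs => rw [g.as_sum_range_C_mul_X_pow, hnat]
    simp [Finset.sum_range_succ, h2]
    ring
  have heval : ∀ x : ℚ, x ^ 4 + a * x ^ 3 + b * x ^ 2 + a * q * x + q ^ 2
      = (x ^ 2 + c * x + d) ^ 2 := by
    intro x
    have := congrArg (eval x) h
    simpa [weilPoly, hcd] using this
  have e0 := heval 0
  have e1 := heval 1
  have e2 := heval (-1)
  have e3 := heval 2
  have e4 := heval (-2)
  have hc : (a : ℚ) = 2 * c := by linarith
  have hb : (b : ℚ) = c ^ 2 + 2 * d := by linarith
  have had : (a : ℚ) * q = 2 * c * d := by linarith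
  have hd : (d - q) * (d + q) = 0 := by linarith
  rcases mul_eq_zero.mp hd with hd | hd
  · left
    have : (4 * b : ℚ) = a ^ 2 + 8 * q := by
      rw [hb, hc, sub_eq_zero.mp hd]; ring
    exact_mod_cast this
  · right
    have hd' : d = -q := by linarith
    have h1 : (a * q : ℚ) = 0 := by
      rw [hd', ← hc] at had; linarith
    have h2 : (4 * b : ℚ) = a ^ 2 - 8 * q := by
      rw [hb, hc, hd']; ring
    exact ⟨by exact_mod_cast h1, by exact_mod_cast h2⟩

/-- If `f(t) = t^4 + a t^3 + b t^2 + a q t + q^2` satisfies condition (a)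
or condition (b) (with `a = 0`), and `f` is either irreducible over `ℚ` or the square of a
monic quadratic polynomial in `ℚ[t]`, then either `f = (t^2 - q)^2` with `q ∈ {2, 3}`, or
`f` is irreducible over `ℚ`. -/
theorem statement0 (q p m : ℕ) (a b : ℤ) (hp : p.Prime) (hq : q = p ^ m) (hm : 0 < m)
    (hcond : PAcond q a b ∨ (a = 0 ∧ PBcond q p b))
    (hshape : Irreducible ((weilPoly q a b).map (Int.castRingHom ℚ)) ∨
      ∃ g : Polynomial ℚ, g.Monic ∧ g.degree = 2 ∧
        (weilPoly q a b).map (Int.castRingHom ℚ) = g ^ 2) :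
    (weilPoly q a b = (X ^ 2 - C (q : ℤ)) ^ 2 ∧ (q = 2 ∨ q = 3)) ∨
      Irreducible ((weilPoly q a b).map (Int.castRingHom ℚ)) := by
  rcases hshape with hirr | ⟨g, hg, hdeg, h⟩
  · exact Or.inr hirr
  left
  have hq0 : 0 < (q : ℤ) := by
    have : 0 < q := hq ▸ pow_pos hp.pos m
    exact_mod_cast this
  have hmid := middle_coeff_of_weilPoly_eq_sq hg hdeg h
  rcases hcond with ⟨hb, hneg, -⟩ | ⟨rfl, hb⟩
  · exfalso
    rcases hmid with hmid | ⟨haq, hmid⟩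
    · linarith
    · obtain rfl : a = 0 := (mul_eq_zero.mp haq).resolve_right hq0.ne'
      linarith
  · have hmid' : b = 2 * q ∨ b = -(2 * q) := by
      rcases hmid with hmid | ⟨-, hmid⟩ <;> omega
    rcases hb with hb | ⟨hb, -⟩ | ⟨hb, -⟩ | ⟨rfl, rfl⟩ | ⟨rfl, rfl⟩
    · omega
    · omega
    · omega
    · refine ⟨?_, Or.inl rfl⟩
      simp [weilPoly]
      ring
    · refine ⟨?_, Or.inr rfl⟩
      simp [weilPoly]
      ring
end

section
/- Let f(t) = t^4 + a t^3 + b t^2 + a q t + q^2 be a polynomial in P_A ∪ P_B. Then the number field K = Q[t]/(f(t)) is a Galois extension of Q. -/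
open Polynomial NumberField

/-- A field generated over `ℚ` by a root of a Weil polynomial is Galois as soon as it contains
all four roots, grouped in two pairs of product `q`. -/
theorem isGalois_of_weilPoly_roots {q : ℕ} {a b : ℤ} {K : Type*} [Field K] [Algebra ℚ K]
    {r₁ r₂ r₃ r₄ : K} (hgen : Algebra.adjoin ℚ {r₁} = ⊤)
    (h₁₂ : r₁ * r₂ = q) (h₃₄ : r₃ * r₄ = q) (hsum : r₁ + r₂ + r₃ + r₄ = -a)
    (hb : (r₁ + r₂) * (r₃ + r₄) + 2 * q = b) : IsGalois ℚ K := by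
  have : CharZero K := algebraRat.charZero K
  set f : ℚ[X] := (weilPoly q a b).map (Int.castRingHom ℚ) with hf
  have hfac : f.map (algebraMap ℚ K) = (X - C r₁) * (X - C r₂) * ((X - C r₃) * (X - C r₄)) := by
    have e₁ := congrArg (C : K → K[X]) h₁₂
    have e₂ := congrArg (C : K → K[X]) h₃₄
    have e₃ := congrArg (C : K → K[X]) hsum
    have e₄ := congrArg (C : K → K[X]) hb
    simp only [map_add, map_mul, map_neg, map_natCast, map_intCast, map_ofNat] at e₁ e₂ e₃ e₄
    have e : f.map (algebraMap ℚ K) =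
        X ^ 4 + (a : K[X]) * X ^ 3 + (b : K[X]) * X ^ 2 + (a : K[X]) * (q : K[X]) * X
          + (q : K[X]) ^ 2 := by
      simp [hf, weilPoly]
    have e₅ : (X - C r₁) * (X - C r₂) = X ^ 2 - (C r₁ + C r₂) * X + (q : K[X]) := by
      rw [← e₁]; ring
    have e₆ : (X - C r₃) * (X - C r₄) = X ^ 2 - (C r₃ + C r₄) * X + (q : K[X]) := by
      rw [← e₂]; ring
    rw [e, e₅, e₆]
    linear_combination (-X ^ 2) * e₄ + (X ^ 3 + (q : K[X]) * X) * e₃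
  have hne : f.map (algebraMap ℚ K) ≠ 0 := by
    rw [hfac]
    exact mul_ne_zero (mul_ne_zero (X_sub_C_ne_zero _) (X_sub_C_ne_zero _))
      (mul_ne_zero (X_sub_C_ne_zero _) (X_sub_C_ne_zero _))
  have hsplit : (f.map (algebraMap ℚ K)).Splits := by
    rw [hfac]
    exact ((Splits.X_sub_C _).mul (Splits.X_sub_C _)).mul
      ((Splits.X_sub_C _).mul (Splits.X_sub_C _))
  have hmem : r₁ ∈ f.rootSet K := by
    rw [mem_rootSet']
    refine ⟨hne, ?_⟩
    rw [aeval_def, ← eval_map, hfac]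
    simp
  have : f.IsSplittingField ℚ K :=
    ⟨hsplit, top_le_iff.mp (hgen ▸ Algebra.adjoin_mono (Set.singleton_subset_iff.mpr hmem))⟩
  have : Normal ℚ K := Normal.of_isSplittingField f
  exact ⟨⟩

/-- If `f(t) = t^4 + a t^3 + b t^2 + a q t + q^2` belongs to `P_A ∪ P_B`,
then the number field `K = ℚ[t]/(f(t))` is a Galois extension of `ℚ`. Here `K` is presented
as a field generated over `ℚ` by a root `π` of `f`. -/
theorem statement1 (q p m : ℕ) (a b : ℤ)
    (hf : inPA q p m a b ∨ (a = 0 ∧ inPB q p m b))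
    (K : Type*) [Field K] [Algebra ℚ K] (π : K)
    (hroot : Polynomial.aeval π (weilPoly q a b) = 0)
    (hgen : Algebra.adjoin ℚ {π} = ⊤) :
    IsGalois ℚ K := by
  have : CharZero K := algebraRat.charZero K
  have hp : p.Prime ∧ q = p ^ m := by
    rcases hf with h | ⟨-, h⟩ <;> exact ⟨h.1, h.2.1⟩
  have hq : (q : K) ≠ 0 := by
    rw [hp.2]
    exact_mod_cast pow_ne_zero m hp.1.ne_zero
  have hr : π ^ 4 + a * π ^ 3 + b * π ^ 2 + a * q * π + (q : K) ^ 2 = 0 := by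
    simpa [weilPoly] using hroot
  have hπ : π ≠ 0 := by
    rintro rfl
    simp [hq] at hr
  rcases hf with ⟨-, -, -, -, hb, hneg, -⟩ | ⟨rfl, -⟩
  · have hbK : (b : K) = a ^ 2 - q := by exact_mod_cast congrArg (Int.cast : ℤ → K) hb
    have hb0 : (b : K) ≠ 0 := by exact_mod_cast hneg.ne
    have hd : π ^ 2 - q ≠ 0 := by
      intro h
      have h₁ : (q : K) * (2 * a * π + (a ^ 2 + q)) = 0 := by
        rw [hbK] at hr
        linear_combination hr - (π ^ 2 + a * π + a ^ 2) * h
      have h₂ := (mul_eq_zero.mp h₁).resolve_left hq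
      apply pow_ne_zero 2 hb0
      rw [hbK]
      linear_combination (a ^ 2 + q - 2 * a * π) * h₂ + 4 * a ^ 2 * h
    have hs : (-a - (π + q / π)) ^ 2 - (b * π / (π ^ 2 - q)) ^ 2 = 4 * q := by
      rw [hbK] at hr ⊢
      field_simp
      linear_combination
        ((π ^ 2 + q) ^ 2 + a * π * (π ^ 2 + q) - (a ^ 2 + 5 * q) * π ^ 2) * hr
    refine isGalois_of_weilPoly_roots (q := q) (a := a) (b := b) (r₂ := q / π)
      (r₃ := (-a - (π + q / π) + b * π / (π ^ 2 - q)) / 2)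
      (r₄ := (-a - (π + q / π) - b * π / (π ^ 2 - q)) / 2) hgen ?_ ?_ ?_ ?_
    · field_simp
    · linear_combination hs / 4
    · ring
    · rw [← add_div, add_add_sub_cancel, add_self_div_two]
      field_simp
      linear_combination -hr
  · refine isGalois_of_weilPoly_roots (q := q) (a := 0) (b := b)
      (r₂ := q / π) (r₃ := -π) (r₄ := -(q / π)) hgen ?_ ?_ ?_ ?_
    · field_simp
    · field_simp
    · simp
    · field_simp
      push_cast at hr
      linear_combination -hr
end

section
/- Let f(t) be a polynomial in P_A ∪ P_B. Then the reduction of f modulo 2 factors in F_2[t] as a product of two monic polynomials of degree 2. -/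
open Polynomial NumberField

theorem map_weilPoly {R : Type*} [CommRing R] (q : ℕ) (a b : ℤ) :
    (weilPoly q a b).map (Int.castRingHom R) =
      X ^ 4 + C (a : R) * X ^ 3 + C (b : R) * X ^ 2 + C (a * q : R) * X + C ((q : R) ^ 2) := by
  simp [weilPoly]

theorem monic_quadratic_and_degree {R : Type*} [CommRing R] [Nontrivial R] (c d : R) :
    (X ^ 2 + C c * X + C d).Monic ∧ (X ^ 2 + C c * X + C d).degree = 2 := by
  constructor
  · monicity!
  · compute_degree!

/-- A biquadratic Weil polynomial becomes a square modulo `2`. -/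
theorem map_weilPoly_eq_sq (q : ℕ) (a b : ℤ) (ha : (a : ZMod 2) = 0) :
    (weilPoly q a b).map (Int.castRingHom (ZMod 2)) =
      (X ^ 2 + C (b : ZMod 2) * X + C (q : ZMod 2)) * (X ^ 2 + C (b : ZMod 2) * X + C (q : ZMod 2))
    := by
  have hb : (b : ZMod 2) ^ 2 = b := ZMod.pow_card _
  have hbC : C (b : ZMod 2) ^ 2 = C (b : ZMod 2) := by rw [← C_pow, hb]
  rw [map_weilPoly, ha, ← sq, CharTwo.add_sq, CharTwo.add_sq, mul_pow, hbC]
  simp only [map_zero, zero_mul, add_zero, C_pow]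
  ring

theorem PAcond.cast_zmod_two {q : ℕ} {a b : ℤ} (h : PAcond q a b) : (b : ZMod 2) = 1 := by
  have hb : ¬ (2 : ℤ) ∣ b := fun hd => absurd (h.2.2 2 Nat.prime_two hd) (by decide)
  have : (b : ZMod 2) ≠ 0 := fun h0 => hb ((ZMod.intCast_zmod_eq_zero_iff_dvd b 2).1 h0)
  generalize (b : ZMod 2) = x at this
  decide +revert

/-- If `f ∈ P_A ∪ P_B`, then the reduction of `f` modulo `2` factors in
`𝔽₂[t]` as a product of two monic polynomials of degree `2`. -/
theorem statement3 (q p m : ℕ) (a b : ℤ)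
    (hf : inPA q p m a b ∨ (a = 0 ∧ inPB q p m b)) :
    ∃ g h : Polynomial (ZMod 2), g.Monic ∧ h.Monic ∧ g.degree = 2 ∧ h.degree = 2 ∧
      (weilPoly q a b).map (Int.castRingHom (ZMod 2)) = g * h := by
  by_cases ha : (a : ZMod 2) = 0
  · obtain ⟨hm, hd⟩ := monic_quadratic_and_degree (b : ZMod 2) (q : ZMod 2)
    exact ⟨_, _, hm, hm, hd, hd, map_weilPoly_eq_sq q a b ha⟩
  · obtain ⟨-, -, -, -, hA⟩ | ⟨rfl, -⟩ := hf
    · have ha1 : (a : ZMod 2) = 1 := by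
        generalize (a : ZMod 2) = x at ha
        decide +revert
      have hb1 := hA.cast_zmod_two
      have hq0 : (q : ZMod 2) = 0 := by
        have h := congrArg (Int.cast : ℤ → ZMod 2) hA.1
        push_cast at h
        rw [ha1, hb1] at h
        linear_combination h
      obtain ⟨hm, hd⟩ := monic_quadratic_and_degree (1 : ZMod 2) 1
      refine ⟨X ^ 2, _, monic_X_pow 2, hm, degree_X_pow 2, hd, ?_⟩
      rw [map_weilPoly, ha1, hb1, hq0]
      simp only [map_one, map_zero, mul_zero, ne_eq, OfNat.ofNat_ne_zero, not_false_eq_true,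
        zero_pow]
      ring
    · simp at ha
end

section
/- Let f(t) = t^4 + a t^3 + b t^2 + a q t + q^2 be a polynomial in P_A. Then b is odd. Moreover, if q is even then a is odd and f(t) ≡ t^2 (t^2 + t + 1) mod 2, while if q is odd then a is even and f(t) ≡ (t^2 + t + 1)^2 mod 2. -/
open Polynomial NumberField

theorem weilPoly_map_zmod_two (q : ℕ) (a b : ℤ) :
    (weilPoly q a b).map (Int.castRingHom (ZMod 2)) =
      X ^ 4 + C (a : ZMod 2) * X ^ 3 + C (b : ZMod 2) * X ^ 2 +
        C ((a : ZMod 2) * (q : ZMod 2)) * X + C ((q : ZMod 2) ^ 2) := by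
  simp [weilPoly, -ZMod.pow_card]

theorem PAcond.odd {q : ℕ} {a b : ℤ} (h : PAcond q a b) : Odd b := by
  rw [← Int.not_even_iff_odd, even_iff_two_dvd]
  intro h2
  exact absurd (h.2.2 2 Nat.prime_two (by exact_mod_cast h2)) (by norm_num)

/-- If `f(t) = t^4 + a t^3 + b t^2 + a q t + q^2 ∈ P_A`, then `b` is odd.
Moreover, if `q` is even then `a` is odd and `f ≡ t^2 (t^2 + t + 1) mod 2`, while if `q` is
odd then `a` is even and `f ≡ (t^2 + t + 1)^2 mod 2`. -/
theorem statement4 (q p m : ℕ) (a b : ℤ) (hf : inPA q p m a b) :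
    Odd b ∧
      (Even q → Odd a ∧ (weilPoly q a b).map (Int.castRingHom (ZMod 2)) =
        X ^ 2 * (X ^ 2 + X + 1)) ∧
      (Odd q → Even a ∧ (weilPoly q a b).map (Int.castRingHom (ZMod 2)) =
        (X ^ 2 + X + 1) ^ 2) := by
  obtain ⟨-, -, -, -, hA⟩ := hf
  have hb := hA.odd
  have hpar : Odd (a ^ 2 - (q : ℤ)) := hA.1 ▸ hb
  refine ⟨hb, fun hq => ?_, fun hq => ?_⟩
  · have ha : Odd a := by
      have hq' : Even (q : ℤ) := by exact_mod_cast hq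
      simpa [Int.odd_sub, hq', Int.odd_pow] using hpar
    refine ⟨ha, ?_⟩
    rw [weilPoly_map_zmod_two, ZMod.intCast_eq_one_iff_odd.mpr ha,
      ZMod.intCast_eq_one_iff_odd.mpr hb, ZMod.natCast_eq_zero_iff_even.mpr hq]
    simp only [map_one, map_zero, mul_zero, ne_eq, OfNat.ofNat_ne_zero, not_false_eq_true,
      zero_pow]
    ring
  · have ha : Even a := by
      have hq' : Odd (q : ℤ) := by exact_mod_cast hq
      have h := hpar.add_odd hq'
      rw [sub_add_cancel] at h
      exact (Int.even_pow.mp h).1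
    refine ⟨ha, ?_⟩
    rw [weilPoly_map_zmod_two, ZMod.intCast_eq_zero_iff_even.mpr ha,
      ZMod.intCast_eq_one_iff_odd.mpr hb, ZMod.natCast_eq_one_iff_odd.mpr hq]
    simp only [map_one, map_zero, zero_mul, one_pow]
    have h2 : (2 : (ZMod 2)[X]) = 0 := CharTwo.two_eq_zero
    linear_combination (-(X ^ 3 + X ^ 2 + X) : (ZMod 2)[X]) * h2
end

section
/- Let f(t) = t^4 + b t^2 + q^2 be a polynomial in P_B, and let K^+ = Q(√(2q − b)) be the real quadratic field generated by a root of f^+(t) = t^2 + (b − 2q), with ring of integers O^+. Then 2 ramifies in K^+: the ideal 2·O^+ is the square of a maximal ideal of O^+. -/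
open Polynomial NumberField

/-- If `g` is a root of a quadratic polynomial which is Eisenstein at `2`, then the ideal `(2, g)`
squares to `(2)`. -/
theorem span_two_eq_span_pair_sq {R : Type*} [CommRing R] {g u w : R}
    (hg : g ^ 2 = 2 * u * g + 2 * (2 * w + 1)) :
    Ideal.span {(2 : R)} = Ideal.span {2, g} ^ 2 := by
  rw [pow_two, Ideal.span_pair_mul_span_pair]
  apply le_antisymm
  · rw [Ideal.span_singleton_le_iff_mem]
    have h : (2 : R) = g * g - u * (2 * g) - w * (2 * 2) := by linear_combination -hg
    have hmem : g * g - u * (2 * g) - w * (2 * 2) ∈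
        Ideal.span {2 * 2, 2 * g, g * 2, g * g} := by
      refine sub_mem (sub_mem (Ideal.subset_span (by simp)) ?_) ?_ <;>
        exact Ideal.mul_mem_left _ _ (Ideal.subset_span (by simp))
    rwa [← h] at hmem
  · rw [Ideal.span_le]
    rintro x (rfl | rfl | rfl | rfl) <;> rw [SetLike.mem_coe, Ideal.mem_span_singleton]
    · exact ⟨2, rfl⟩
    · exact ⟨g, rfl⟩
    · exact ⟨g, mul_comm _ _⟩
    · exact ⟨u * g + (2 * w + 1), by linear_combination hg⟩

/-- A number field generated by a square root of an integer has degree at most `2`. -/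
theorem finrank_le_two_of_adjoin_sqrt {K : Type*} [Field K] [NumberField K] {α : K} {D : ℤ}
    (hα : α ^ 2 = (D : K)) (hgen : Algebra.adjoin ℚ {α} = ⊤) : Module.finrank ℚ K ≤ 2 := by
  have htop : IntermediateField.adjoin ℚ {α} = ⊤ :=
    IntermediateField.adjoin_eq_top_of_algebra ℚ {α} hgen
  rw [← IntermediateField.finrank_top', ← htop,
    IntermediateField.adjoin.finrank (Algebra.IsIntegral.isIntegral α)]
  have hdvd : minpoly ℚ α ∣ X ^ 2 - C (D : ℚ) := minpoly.dvd _ _ (by simp [hα])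
  have hle := natDegree_le_of_dvd hdvd (X_pow_sub_C_ne_zero two_pos _)
  rwa [natDegree_X_pow_sub_C] at hle

/-- In a number field of degree at most `2`, an ideal whose square is `(2)` is maximal. -/
theorem isMaximal_of_sq_eq_span_two {K : Type*} [Field K] [NumberField K]
    (hK : Module.finrank ℚ K ≤ 2) {I : Ideal (𝓞 K)} (hI : Ideal.span {(2 : 𝓞 K)} = I ^ 2) :
    I.IsMaximal := by
  have hnorm : Ideal.absNorm I ^ 2 = 2 ^ Module.finrank ℚ K := by
    rw [← map_pow, ← hI, Ideal.absNorm_span_singleton,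
      show (2 : 𝓞 K) = algebraMap ℤ (𝓞 K) 2 by simp, Algebra.norm_algebraMap,
      RingOfIntegers.rank, Int.natAbs_pow]
    rfl
  have hpos : 0 < Module.finrank ℚ K := Module.finrank_pos
  have hI2 : Ideal.absNorm I = 2 := by
    obtain h | h : Module.finrank ℚ K = 1 ∨ Module.finrank ℚ K = 2 := by omega
    all_goals
      rw [h] at hnorm
      have : Ideal.absNorm I ≤ 2 := by nlinarith
      interval_cases Ideal.absNorm I <;> simp_all
  have hprime : I.IsPrime :=
    Ideal.isPrime_of_irreducible_absNorm (by rw [hI2]; exact Nat.prime_two)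
  refine hprime.isMaximal ?_
  rintro rfl
  simp at hI2

/-- The prime `2` is totally ramified in a number field generated by a square root of `s ^ 2 * d`
with `d ≡ 2, 3 mod 4`. -/
theorem exists_isMaximal_sq_eq_span_two {K : Type*} [Field K] [NumberField K] {α : K} {s d : ℤ}
    (hs : s ≠ 0) (hd : d % 4 = 2 ∨ d % 4 = 3) (hα : α ^ 2 = ((s ^ 2 * d : ℤ) : K))
    (hgen : Algebra.adjoin ℚ {α} = ⊤) :
    ∃ 𝔪 : Ideal (𝓞 K), 𝔪.IsMaximal ∧ Ideal.span {(2 : 𝓞 K)} = 𝔪 ^ 2 := by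
  have hs' : (s : K) ≠ 0 := Int.cast_ne_zero.mpr hs
  have hsq : (α / s) ^ 2 = (d : K) := by
    rw [div_pow, hα]
    push_cast
    field_simp
  have hint : IsIntegral ℤ (α / s) := by
    refine IsIntegral.of_pow two_pos ?_
    rw [hsq]
    exact isIntegral_algebraMap (R := ℤ) (x := d)
  obtain ⟨β, hβα⟩ : ∃ β : 𝓞 K, algebraMap (𝓞 K) K β = α / s := ⟨⟨α / s, hint⟩, rfl⟩
  have hβ : β ^ 2 = (d : 𝓞 K) :=
    RingOfIntegers.coe_injective (by rw [map_pow, map_intCast, hβα, hsq])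
  obtain ⟨g, u, w, hg⟩ : ∃ g u w : 𝓞 K, g ^ 2 = 2 * u * g + 2 * (2 * w + 1) := by
    rcases hd with hd | hd
    · refine ⟨β, 0, ((d / 4 : ℤ) : 𝓞 K), ?_⟩
      have hd' : d = 4 * (d / 4) + 2 := by omega
      have hc : (d : 𝓞 K) = 4 * ((d / 4 : ℤ) : 𝓞 K) + 2 := by exact_mod_cast hd'
      linear_combination hβ + hc
    · refine ⟨β + 1, 1, ((d / 4 : ℤ) : 𝓞 K), ?_⟩
      have hd' : d = 4 * (d / 4) + 3 := by omega
      have hc : (d : 𝓞 K) = 4 * ((d / 4 : ℤ) : 𝓞 K) + 3 := by exact_mod_cast hd'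
      linear_combination hβ + hc
  have h := span_two_eq_span_pair_sq hg
  exact ⟨_, isMaximal_of_sq_eq_span_two (finrank_le_two_of_adjoin_sqrt hα hgen) h, h⟩

/-- The discriminant `2q - b` of a polynomial in `P_B` is a nonzero square times an integer
`≡ 2, 3 mod 4`. -/
theorem inPB.exists_two_mul_sub_eq {q p m : ℕ} {b : ℤ} (hf : inPB q p m b) :
    ∃ s d : ℤ, s ≠ 0 ∧ (d % 4 = 2 ∨ d % 4 = 3) ∧ 2 * (q : ℤ) - b = s ^ 2 * d := by
  obtain ⟨hp, hq, -, -, hb⟩ := hf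
  have hq0 : q ≠ 0 := hq ▸ pow_ne_zero m hp.ne_zero
  have three_mul_of_isSquare (h : IsSquare q) :
      ∃ s d : ℤ, s ≠ 0 ∧ (d % 4 = 2 ∨ d % 4 = 3) ∧ 2 * (q : ℤ) - -q = s ^ 2 * d := by
    obtain ⟨r, rfl⟩ := h
    exact ⟨r, 3, by simpa using hq0, by norm_num, by push_cast; ring⟩
  rcases hb with rfl | ⟨rfl, -⟩ | ⟨rfl, ⟨-, h⟩ | ⟨-, h⟩ | ⟨rfl, h⟩⟩ | ⟨rfl, rfl⟩ | ⟨rfl, rfl⟩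
  · exact ⟨1, 4 * q - 1, one_ne_zero, by omega, by ring⟩
  · exact ⟨1, 4 * q - 2, one_ne_zero, by omega, by ring⟩
  · exact three_mul_of_isSquare h
  · exact three_mul_of_isSquare h
  · obtain ⟨k, rfl | rfl⟩ := m.even_or_odd'
    · exact absurd ⟨2 ^ k, by rw [hq]; ring⟩ h
    · exact ⟨2 ^ k, 6, by positivity, by norm_num, by rw [hq]; push_cast; ring⟩
  · exact ⟨2, 2, by norm_num, by norm_num, by norm_num⟩
  · exact ⟨2, 3, by norm_num, by norm_num, by norm_num⟩

/-- Let `f(t) = t^4 + b t^2 + q^2 ∈ P_B` and let `K⁺ = ℚ(√(2q − b))` be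
the real quadratic field generated by a root of `f⁺(t) = t^2 + (b − 2q)`, with ring of
integers `O⁺`. Then `2` ramifies in `K⁺`: the ideal `2·O⁺` is the square of a maximal
ideal of `O⁺`. -/
theorem statement5 (q p m : ℕ) (b : ℤ) (hf : inPB q p m b)
    (Kp : Type*) [Field Kp] [NumberField Kp] (α : Kp)
    (hα : α ^ 2 = ((2 * (q : ℤ) - b : ℤ) : Kp))
    (hgen : Algebra.adjoin ℚ {α} = ⊤) :
    ∃ 𝔪 : Ideal (𝓞 Kp), 𝔪.IsMaximal ∧
      Ideal.span {(2 : 𝓞 Kp)} = 𝔪 ^ 2 := by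
  obtain ⟨s, d, hs, hd, hD⟩ := hf.exists_two_mul_sub_eq
  exact exists_isMaximal_sq_eq_span_two hs hd (by rw [hα, hD]) hgen
end

section
/- Let f(t) = t^4 + b t^2 + q^2 be a polynomial in P_B, let K = Q[t]/(f(t)) with π the class of t, let K^+ = Q(π + q/π) be its real quadratic subfield, and let O and O^+ be the rings of integers of K and K^+. Let 𝔪 be the unique maximal ideal of O^+ above 2. Then the following are equivalent: (i) the extension K/K^+ is ramified, i.e., some maximal ideal of O^+ has ramification index greater than 1 in O; (ii) 𝔪 is the unique maximal ideal of O^+ that ramifies in K; (iii) 2 is totally ramified in K, i.e., 2·O = 𝔓^4 for a maximal ideal 𝔓 of O; (iv) b = 2 − 2q and q is odd. Moreover, if any of these equivalent conditions holds, then f is ordinary, i.e., b is coprime to p. -/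
open Polynomial NumberField

/-- If `L = K(x)` with `x` a root of a monic quadratic polynomial with coefficients in `𝓞 K`,
every maximal ideal of `𝓞 K` ramifying in `L` contains the discriminant of the polynomial. -/
theorem discrim_mem_of_sq_dvd_map {K L : Type*} [Field K] [NumberField K] [Field L]
    [NumberField L] [Algebra K L] (s n : 𝓞 K) (x : L)
    (hx : x ^ 2 - algebraMap (𝓞 K) L s * x + algebraMap (𝓞 K) L n = 0)
    (hgen : Algebra.adjoin K {x} = ⊤) {𝔭 : Ideal (𝓞 K)} (h𝔭 : 𝔭.IsMaximal)
    {𝔓 : Ideal (𝓞 L)} (h𝔓 : 𝔓.IsMaximal)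
    (hdvd : 𝔓 ^ 2 ∣ 𝔭.map (algebraMap (𝓞 K) (𝓞 L))) : s ^ 2 - 4 * n ∈ 𝔭 := by
  have hf : aeval x (X ^ 2 - C s * X + C n : (𝓞 K)[X]) = 0 := by simpa using hx
  have hmon : (X ^ 2 - C s * X + C n : (𝓞 K)[X]).Monic := by monicity!
  have hint : IsIntegral (𝓞 K) x := ⟨_, hmon, hf⟩
  obtain ⟨y, rfl⟩ : ∃ y : 𝓞 L, algebraMap (𝓞 L) L y = x :=
    ⟨⟨x, isIntegral_trans (R := ℤ) x hint⟩, rfl⟩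
  have hy : aeval y (X ^ 2 - C s * X + C n : (𝓞 K)[X]) = 0 := by
    apply FaithfulSMul.algebraMap_injective (𝓞 L) L
    rw [← aeval_algebraMap_apply, hf, map_zero]
  obtain ⟨g, hg⟩ := minpoly.isIntegrallyClosed_dvd
    (Algebra.IsIntegral.isIntegral (R := 𝓞 K) y) hy
  have hmem : aeval y (derivative (X ^ 2 - C s * X + C n : (𝓞 K)[X])) ∈
      differentIdeal (𝓞 K) (𝓞 L) := by
    rw [hg, derivative_mul, map_add, map_mul, map_mul, minpoly.aeval, zero_mul, add_zero]
    exact Ideal.mul_mem_right _ _ (aeval_derivative_mem_differentIdeal (𝓞 K) K L y hgen)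
  have hdiff : 𝔓 ∣ differentIdeal (𝓞 K) (𝓞 L) := by
    simpa using pow_sub_one_dvd_differentIdeal (𝓞 K) 𝔓 2
      (Ring.ne_bot_of_isMaximal_of_not_isField h𝔭 (RingOfIntegers.not_isField K)) hdvd
  have hmem𝔓 := Ideal.dvd_iff_le.mp hdiff hmem
  have hle : 𝔭 ≤ 𝔓.comap (algebraMap (𝓞 K) (𝓞 L)) :=
    Ideal.map_le_iff_le_comap.mp <|
      Ideal.dvd_iff_le.mp ((dvd_pow_self 𝔓 two_ne_zero).trans hdvd)
  rw [h𝔭.eq_of_le (Ideal.comap_ne_top _ h𝔓.ne_top) hle, Ideal.mem_comap]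
  have hsq : algebraMap (𝓞 K) (𝓞 L) (s ^ 2 - 4 * n) =
      aeval y (derivative (X ^ 2 - C s * X + C n : (𝓞 K)[X])) ^ 2 := by
    simp at hy ⊢
    rw [map_ofNat]
    linear_combination -4 * hy
  rw [hsq]
  exact Ideal.pow_mem_of_mem _ hmem𝔓 2 two_pos

theorem finrank_le_natDegree_of_adjoin_eq_top {F K : Type*} [Field F] [Field K] [Algebra F K]
    {x : K} (hx : Algebra.adjoin F {x} = ⊤) {f : F[X]} (hf : f ≠ 0) (hroot : aeval x f = 0) :
    Module.finrank F K ≤ f.natDegree := by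
  have hint : IsIntegral F x := IsAlgebraic.isIntegral ⟨f, hf, hroot⟩
  have htop : IntermediateField.adjoin F {x} = ⊤ := by
    rw [← IntermediateField.toSubalgebra_inj, IntermediateField.top_toSubalgebra, eq_top_iff,
      ← hx]
    exact IntermediateField.algebra_adjoin_le_adjoin F {x}
  rw [← IntermediateField.finrank_top', ← htop, IntermediateField.adjoin.finrank hint]
  exact natDegree_le_of_dvd (minpoly.dvd F x hroot) hf

theorem absNorm_pow_eq_two_pow_finrank {K : Type*} [Field K] [NumberField K]
    {I : Ideal (𝓞 K)} {n : ℕ} (hI : I ^ n = Ideal.span {2}) :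
    Ideal.absNorm I ^ n = 2 ^ Module.finrank ℚ K := by
  rw [← map_pow, hI, ← RingOfIntegers.rank K]
  exact_mod_cast Ideal.absNorm_span_natCast (S := 𝓞 K) 2

theorem isMaximal_of_pow_eq_span_two {K : Type*} [Field K] [NumberField K] {I : Ideal (𝓞 K)}
    {n : ℕ} (hI : I ^ n = Ideal.span {2}) (hn : Module.finrank ℚ K ≤ n) : I.IsMaximal := by
  have hN := absNorm_pow_eq_two_pow_finrank hI
  have hd : 0 < Module.finrank ℚ K := Module.finrank_pos
  have hle : Ideal.absNorm I ≤ 2 := by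
    rw [← Nat.pow_le_pow_iff_left (n := n) (by omega), hN]
    exact Nat.pow_le_pow_right two_pos hn
  have hlt : 1 < 2 ^ Module.finrank ℚ K := Nat.one_lt_two_pow hd.ne'
  have h2 : Ideal.absNorm I = 2 := by
    interval_cases h : Ideal.absNorm I
    · rw [zero_pow (by omega)] at hN; omega
    · rw [one_pow] at hN; omega
    · rfl
  have hprime : I.IsPrime := Ideal.isPrime_of_irreducible_absNorm <| by
    rw [h2]; exact Nat.prime_two
  refine hprime.isMaximal ?_
  rintro rfl
  simp at h2

theorem exists_pow_eq_of_forall_isMaximal {R : Type*} [CommRing R] [IsDedekindDomain R]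
    {I 𝔪 : Ideal R} (hI : I ≠ ⊥) (h : ∀ 𝔭 : Ideal R, 𝔭.IsMaximal → I ≤ 𝔭 → 𝔭 = 𝔪) :
    ∃ k, 𝔪 ^ k = I := by
  classical
  refine ⟨Multiset.card (UniqueFactorizationMonoid.normalizedFactors I), ?_⟩
  conv_rhs => rw [← Ideal.prod_normalizedFactors_eq_self hI]
  rw [← Multiset.prod_replicate, eq_comm]
  congr 1
  refine Multiset.eq_replicate_card.mpr fun 𝔭 h𝔭 ↦ ?_
  have hp := UniqueFactorizationMonoid.prime_of_normalized_factor 𝔭 h𝔭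
  exact h 𝔭 ((Ideal.isPrime_of_prime hp).isMaximal hp.ne_zero) <| Ideal.dvd_iff_le.mp <|
    UniqueFactorizationMonoid.dvd_of_mem_normalizedFactors h𝔭

/-- If `2` is totally ramified in a quartic extension of `ℚ`, the prime above `2` of a quadratic
subfield ramifies. -/
theorem sq_dvd_map_of_span_two_eq_pow_four {K L : Type*} [Field K] [NumberField K] [Field L]
    [NumberField L] [Algebra K L] (hK : Module.finrank ℚ K ≤ 2)
    {𝔪 : Ideal (𝓞 K)} (h𝔪 : 𝔪.IsMaximal)
    (huniq : ∀ 𝔭 : Ideal (𝓞 K), 𝔭.IsMaximal → (2 : 𝓞 K) ∈ 𝔭 → 𝔭 = 𝔪)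
    {𝔓 : Ideal (𝓞 L)} (h𝔓 : Ideal.span {(2 : 𝓞 L)} = 𝔓 ^ 4) :
    𝔓 ^ 2 ∣ 𝔪.map (algebraMap (𝓞 K) (𝓞 L)) := by
  obtain ⟨k, hk⟩ := exists_pow_eq_of_forall_isMaximal (I := Ideal.span {(2 : 𝓞 K)}) (𝔪 := 𝔪)
    (by simp) fun 𝔭 h𝔭 hle ↦ huniq 𝔭 h𝔭 ((Ideal.span_singleton_le_iff_mem _).mp hle)
  have hN := absNorm_pow_eq_two_pow_finrank hk
  have hd : 0 < Module.finrank ℚ K := Module.finrank_pos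
  have hk0 : k ≠ 0 := by
    rintro rfl
    exact (Nat.one_lt_two_pow hd.ne').ne hN
  have hN1 : Ideal.absNorm 𝔪 ≠ 1 := by
    rw [Ne, Ideal.absNorm_eq_one_iff]; exact h𝔪.ne_top
  have hN0 : Ideal.absNorm 𝔪 ≠ 0 := fun h ↦ by
    rw [h, zero_pow hk0] at hN
    exact (pow_ne_zero _ two_ne_zero) hN.symm
  have hk2 : k ≤ 2 := by
    refine le_trans ?_ hK
    rw [← Nat.pow_le_pow_iff_right (a := 2) one_lt_two, ← hN]
    exact Nat.pow_le_pow_left (by omega) k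
  rw [← UniqueFactorizationMonoid.pow_dvd_pow_iff_dvd hk0, ← Ideal.map_pow, hk, Ideal.map_span, Set.image_singleton,
    map_ofNat, h𝔓, ← pow_mul]
  exact pow_dvd_pow _ (by omega)

theorem adjoin_eq_top_of_mem {F K L : Type*} [Field F] [Field K] [Field L] [Algebra F K]
    [Algebra F L] [Algebra K L] [IsScalarTower F K L] {x y : L}
    (hx : Algebra.adjoin F {x} = ⊤) (hy : x ∈ Algebra.adjoin K {y}) :
    Algebra.adjoin K {y} = ⊤ := by
  have h : Algebra.adjoin F {x} ≤ (Algebra.adjoin K {y}).restrictScalars F :=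
    Algebra.adjoin_le (Set.singleton_subset_iff.mpr hy)
  exact eq_top_iff.mpr fun z _ ↦ h (hx ▸ Algebra.mem_top)

theorem not_irreducible_weilPoly_of_eq_neg_two_mul (q : ℕ) :
    ¬ Irreducible ((weilPoly q 0 (-2 * q)).map (Int.castRingHom ℚ)) := by
  have h : weilPoly q 0 (-2 * q) = (X ^ 2 - C (q : ℤ)) ^ 2 := by
    simp [weilPoly]
    ring
  rw [h, Polynomial.map_pow]
  exact not_irreducible_pow (by norm_num)

/-- If `π ^ 2 = δ * π + q`, `δ ^ 2 = -2` and `q` is odd, then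
`(δ, π + 1)` has fourth power `(2)`. -/
theorem span_pair_pow_four_eq_span_two {R : Type*} [CommRing R] {q : ℕ} (hq : Odd q) {π δ : R}
    (hπ : π ^ 2 = δ * π + q) (hδ : δ ^ 2 = -2) :
    Ideal.span {δ, π + 1} ^ 4 = Ideal.span {(2 : R)} := by
  obtain ⟨k, rfl⟩ := hq
  push_cast at hπ
  have hsq : Ideal.span {δ, π + 1} ^ 2 = Ideal.span {δ} := by
    apply le_antisymm
    · rw [sq, Ideal.span_pair_mul_span_pair, Ideal.span_le]
      rintro x (rfl | rfl | rfl | rfl) <;>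
        rw [SetLike.mem_coe, Ideal.mem_span_singleton']
      · exact ⟨δ, rfl⟩
      · exact ⟨π + 1, by ring⟩
      · exact ⟨π + 1, by ring⟩
      · exact ⟨π - δ * π - (k + 1) * δ, by linear_combination -(π + k + 1) * hδ - hπ⟩
    · have h1 : δ ∈ Ideal.span {δ, π + 1} := Ideal.subset_span (by simp)
      have h2 : π + 1 ∈ Ideal.span {δ, π + 1} := Ideal.subset_span (by simp)
      rw [Ideal.span_singleton_le_iff_mem]
      have h := Ideal.sub_mem _ (Ideal.sub_mem _ (Ideal.mul_mem_mul h1 h2)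
        (Ideal.mul_mem_mul h2 h2)) (Ideal.mul_mem_left _ (π + k + 1) (Ideal.mul_mem_mul h1 h1))
      rw [sq]
      convert h using 1
      linear_combination (π + k + 1) * hδ + hπ
  rw [show 4 = 2 * 2 from rfl, pow_mul, hsq, Ideal.span_singleton_pow, hδ,
    Ideal.span_singleton_neg]

/-- Let `f(t) = t^4 + b t^2 + q^2 ∈ P_B`, `K = ℚ[t]/(f)` with root `π`,
`K⁺ = ℚ(π + q/π)` its real quadratic subfield, `O`, `O⁺` the rings of integers, and `𝔪`
the unique maximal ideal of `O⁺` above `2`. Then the following are equivalent: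
(i) `K/K⁺` is ramified; (ii) `𝔪` is the unique maximal ideal of `O⁺` ramifying in `K`;
(iii) `2` is totally ramified in `K`; (iv) `b = 2 − 2q` and `q` is odd.
Moreover, if these hold then `f` is ordinary, i.e. `b` is coprime to `p`. -/
theorem statement6 (q p m : ℕ) (b : ℤ) (hf : inPB q p m b)
    (K : Type*) [Field K] [NumberField K] (π : K)
    (hroot : Polynomial.aeval π (weilPoly q 0 b) = 0)
    (hgen : Algebra.adjoin ℚ {π} = ⊤)
    (Kp : Type*) [Field Kp] [NumberField Kp] [Algebra Kp K] [IsScalarTower ℚ Kp K]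
    (ρ : Kp) (hρ : algebraMap Kp K ρ = π + (q : K) / π)
    (hgenp : Algebra.adjoin ℚ {ρ} = ⊤)
    (𝔪 : Ideal (𝓞 Kp)) (h𝔪max : 𝔪.IsMaximal) (h𝔪2 : (2 : 𝓞 Kp) ∈ 𝔪)
    (h𝔪uniq : ∀ 𝔭 : Ideal (𝓞 Kp), 𝔭.IsMaximal → (2 : 𝓞 Kp) ∈ 𝔭 → 𝔭 = 𝔪) :
    ((∃ 𝔭 : Ideal (𝓞 Kp), 𝔭.IsMaximal ∧ ∃ 𝔓 : Ideal (𝓞 K), 𝔓.IsMaximal ∧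
        𝔓 ^ 2 ∣ Ideal.map (algebraMap (𝓞 Kp) (𝓞 K)) 𝔭) ↔
      ((∃ 𝔓 : Ideal (𝓞 K), 𝔓.IsMaximal ∧
          𝔓 ^ 2 ∣ Ideal.map (algebraMap (𝓞 Kp) (𝓞 K)) 𝔪) ∧
        ∀ 𝔭 : Ideal (𝓞 Kp), 𝔭.IsMaximal →
          (∃ 𝔓 : Ideal (𝓞 K), 𝔓.IsMaximal ∧
            𝔓 ^ 2 ∣ Ideal.map (algebraMap (𝓞 Kp) (𝓞 K)) 𝔭) → 𝔭 = 𝔪)) ∧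
    ((∃ 𝔭 : Ideal (𝓞 Kp), 𝔭.IsMaximal ∧ ∃ 𝔓 : Ideal (𝓞 K), 𝔓.IsMaximal ∧
        𝔓 ^ 2 ∣ Ideal.map (algebraMap (𝓞 Kp) (𝓞 K)) 𝔭) ↔
      (∃ 𝔓 : Ideal (𝓞 K), 𝔓.IsMaximal ∧ Ideal.span {(2 : 𝓞 K)} = 𝔓 ^ 4)) ∧
    ((∃ 𝔭 : Ideal (𝓞 Kp), 𝔭.IsMaximal ∧ ∃ 𝔓 : Ideal (𝓞 K), 𝔓.IsMaximal ∧
        𝔓 ^ 2 ∣ Ideal.map (algebraMap (𝓞 Kp) (𝓞 K)) 𝔭) ↔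
      (b = 2 - 2 * (q : ℤ) ∧ Odd q)) ∧
    ((b = 2 - 2 * (q : ℤ) ∧ Odd q) → IsCoprime b (p : ℤ)) := by
  obtain ⟨hp, hqp, hm, hirr, hcond⟩ := hf
  have hq0 : q ≠ 0 := hqp ▸ pow_ne_zero _ hp.ne_zero
  have hf0 : π ^ 4 + b * π ^ 2 + (q : K) ^ 2 = 0 := by
    simpa [weilPoly] using hroot
  have hqK : (q : K) ≠ 0 := Nat.cast_ne_zero.mpr hq0
  have hπ0 : π ≠ 0 := by
    rintro rfl
    simp [hq0] at hf0
  have hquad : π ^ 2 - algebraMap Kp K ρ * π + q = 0 := by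
    rw [hρ]
    field_simp
    ring
  have hρsq : ρ ^ 2 = 2 * q - b := by
    apply (algebraMap Kp K).injective
    simp only [map_pow, map_sub, map_mul, map_ofNat, map_natCast, map_intCast, hρ]
    field_simp
    linear_combination hf0
  obtain ⟨r, rfl⟩ : ∃ r : 𝓞 Kp, algebraMap (𝓞 Kp) Kp r = ρ :=
    ⟨⟨ρ, .of_pow two_pos (hρsq ▸ by exact_mod_cast isIntegral_algebraMap (x := 2 * q - b))⟩, rfl⟩
  have hr : r ^ 2 = (2 * q - b : ℤ) := by
    apply FaithfulSMul.algebraMap_injective (𝓞 Kp) Kp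
    rw [map_pow, map_intCast, hρsq]
    push_cast
    rfl
  have hR : algebraMap (𝓞 Kp) K r ^ 2 = (2 * q - b : ℤ) := by
    rw [← map_pow, hr, map_intCast]
  rw [← IsScalarTower.algebraMap_apply] at hquad
  have hgenKp : Algebra.adjoin Kp {π} = ⊤ :=
    adjoin_eq_top_of_mem hgen (Algebra.self_mem_adjoin_singleton _ _)
  have hdisc : ∀ 𝔭 : Ideal (𝓞 Kp), 𝔭.IsMaximal →
      (∃ 𝔓 : Ideal (𝓞 K), 𝔓.IsMaximal ∧
        𝔓 ^ 2 ∣ Ideal.map (algebraMap (𝓞 Kp) (𝓞 K)) 𝔭) → (-(b + 2 * q : ℤ) : 𝓞 Kp) ∈ 𝔭 := by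
    rintro 𝔭 h𝔭 ⟨𝔓, h𝔓, hdvd⟩
    have h := discrim_mem_of_sq_dvd_map r q π (by simpa using hquad) hgenKp h𝔭 h𝔓 hdvd
    convert h using 1
    push_cast at hr ⊢
    linear_combination -hr
  have hrank : Module.finrank ℚ Kp ≤ 2 := by
    refine (finrank_le_natDegree_of_adjoin_eq_top hgenp
      (f := X ^ 2 - C (2 * q - b : ℚ)) ?_ (by simp [hρsq])).trans (by compute_degree)
    exact Monic.ne_zero (by monicity!)
  have hrank4 : Module.finrank ℚ K ≤ 4 := by
    refine (finrank_le_natDegree_of_adjoin_eq_top hgen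
      (f := X ^ 4 + C (b : ℚ) * X ^ 2 + C (q : ℚ) ^ 2) ?_ (by simpa using hf0)).trans
      (by compute_degree)
    exact Monic.ne_zero (by monicity!)
  have hram : (∃ 𝔭 : Ideal (𝓞 Kp), 𝔭.IsMaximal ∧ ∃ 𝔓 : Ideal (𝓞 K), 𝔓.IsMaximal ∧
      𝔓 ^ 2 ∣ Ideal.map (algebraMap (𝓞 Kp) (𝓞 K)) 𝔭) → b = 2 - 2 * (q : ℤ) ∧ Odd q := by
    rintro ⟨𝔭, h𝔭, hP⟩
    have hd := hdisc 𝔭 h𝔭 hP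
    obtain ⟨𝔓, h𝔓, hdvd⟩ := hP
    rcases hcond with rfl | ⟨rfl, hp2⟩ | ⟨rfl, hcase⟩ | ⟨rfl, rfl⟩ | ⟨rfl, rfl⟩
    · refine absurd ((Ideal.eq_top_iff_one 𝔭).mpr ?_) h𝔭.ne_top
      simpa using hd
    · exact ⟨rfl, hqp ▸ (hp.odd_of_ne_two hp2.ne').pow⟩
    · exfalso
      have h3 : (3 : 𝓞 Kp) ∈ 𝔭 := by
        have h := discrim_mem_of_sq_dvd_map (K := Kp) 1 1 (π ^ 2 / q) ?_
          (adjoin_eq_top_of_mem hgen ?_) h𝔭 h𝔓 hdvd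
        · rw [← neg_mem_iff]
          convert h using 1
          norm_num
        · rw [map_one]
          push_cast at hf0
          field_simp
          linear_combination hf0
        · have hρ0 : algebraMap (𝓞 Kp) K r ≠ 0 := fun h ↦ by
            rw [h] at hR
            have : 2 * (q : ℤ) - -q = 0 := by exact_mod_cast hR.symm
            omega
          have hπ : π = (q / algebraMap (𝓞 Kp) Kp r) • (π ^ 2 / q + 1 : K) := by
            rw [Algebra.smul_def, map_div₀, map_natCast, ← IsScalarTower.algebraMap_apply]
            field_simp
            linear_combination -hquad
          rw [hπ]
          exact Subalgebra.smul_mem _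
            (add_mem (hπ ▸ Algebra.self_mem_adjoin_singleton _ _) (one_mem _)) _
      have hdisj : (p % 12 = 11 ∨ p = 3) ∧ IsSquare q ∨ p = 2 := by tauto
      rcases hdisj with ⟨-, l, rfl⟩ | rfl
      · have h4 : (4 : 𝓞 Kp) ∈ 𝔭 := by
          have hl : (l : K) ≠ 0 := by simpa using hqK
          have h := discrim_mem_of_sq_dvd_map (K := Kp) 0 1
            ((2 * π - algebraMap (𝓞 Kp) K r) / l) ?_
            (adjoin_eq_top_of_mem hgen ?_) h𝔭 h𝔓 hdvd
          · rw [← neg_mem_iff]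
            convert h using 1
            norm_num
          · rw [map_one, map_zero]
            push_cast at hR hquad
            field_simp
            linear_combination 4 * hquad + hR
          · set y := (2 * π - algebraMap (𝓞 Kp) K r) / l with hy
            have hπ : π = (l / 2 : Kp) • y + algebraMap Kp K (algebraMap (𝓞 Kp) Kp r / 2) := by
              rw [Algebra.smul_def, map_div₀, map_div₀, map_natCast, map_ofNat,
                ← IsScalarTower.algebraMap_apply, hy]
              field_simp
              ring
            rw [hπ]
            exact add_mem (Subalgebra.smul_mem _ (Algebra.self_mem_adjoin_singleton _ _) _)
              (Subalgebra.algebraMap_mem _ _)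
        refine h𝔭.ne_top ((Ideal.eq_top_iff_one 𝔭).mpr ?_)
        convert sub_mem h4 h3 using 1
        norm_num
      · have h2 : (2 : 𝓞 Kp) ∈ 𝔭 := by
          refine h𝔭.isPrime.mem_of_pow_mem m ?_
          rw [← neg_mem_iff]
          convert hd using 1
          subst hqp
          push_cast
          ring
        refine h𝔭.ne_top ((Ideal.eq_top_iff_one 𝔭).mpr ?_)
        convert sub_mem h3 h2 using 1
        norm_num
    · exact absurd hirr (not_irreducible_weilPoly_of_eq_neg_two_mul 2)
    · exact absurd hirr (not_irreducible_weilPoly_of_eq_neg_two_mul 3)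
  have htot : b = 2 - 2 * (q : ℤ) ∧ Odd q →
      ∃ 𝔓 : Ideal (𝓞 K), 𝔓.IsMaximal ∧ Ideal.span {(2 : 𝓞 K)} = 𝔓 ^ 4 := by
    rintro ⟨rfl, hodd⟩
    obtain ⟨x, rfl⟩ : ∃ x : 𝓞 K, algebraMap (𝓞 K) K x = π :=
      ⟨⟨π, weilPoly q 0 _, by rw [weilPoly]; monicity!, hroot⟩, rfl⟩
    have hx : x ^ 2 - algebraMap (𝓞 Kp) (𝓞 K) r * x + q = 0 := by
      apply FaithfulSMul.algebraMap_injective (𝓞 K) K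
      simpa [← IsScalarTower.algebraMap_apply] using hquad
    have hr' : algebraMap (𝓞 Kp) (𝓞 K) r ^ 2 = 2 * q - (2 - 2 * q) := by
      rw [← map_pow, hr, map_intCast]
      push_cast
      rfl
    have hpow := span_pair_pow_four_eq_span_two hodd (π := x)
      (δ := 2 * x - algebraMap (𝓞 Kp) (𝓞 K) r) (by linear_combination -hx)
      (by linear_combination 4 * hx + hr')
    exact ⟨_, isMaximal_of_pow_eq_span_two hpow hrank4, hpow.symm⟩
  have hm𝔪 : (∃ 𝔓 : Ideal (𝓞 K), 𝔓.IsMaximal ∧ Ideal.span {(2 : 𝓞 K)} = 𝔓 ^ 4) →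
      ∃ 𝔓 : Ideal (𝓞 K), 𝔓.IsMaximal ∧
        𝔓 ^ 2 ∣ Ideal.map (algebraMap (𝓞 Kp) (𝓞 K)) 𝔪 := by
    rintro ⟨𝔓, h𝔓, h2⟩
    exact ⟨𝔓, h𝔓, sq_dvd_map_of_span_two_eq_pow_four hrank h𝔪max h𝔪uniq h2⟩
  refine ⟨⟨fun h ↦ ⟨hm𝔪 (htot (hram h)), fun 𝔭 h𝔭 hP ↦ h𝔪uniq 𝔭 h𝔭 ?_⟩,
    fun h ↦ ⟨𝔪, h𝔪max, h.1⟩⟩, ⟨fun h ↦ htot (hram h), fun h ↦ ⟨𝔪, h𝔪max, hm𝔪 h⟩⟩,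
    ⟨hram, fun h ↦ ⟨𝔪, h𝔪max, hm𝔪 (htot h)⟩⟩, ?_⟩
  · have hd := hdisc 𝔭 h𝔭 hP
    rw [(hram h).1] at hd
    simpa using hd
  · rintro ⟨rfl, hodd⟩
    have hp2 : IsCoprime (2 : ℤ) p := by
      rw [hqp, Nat.odd_pow_iff hm.ne'] at hodd
      exact_mod_cast Nat.isCoprime_iff_coprime.mpr hodd.coprime_two_left
    obtain ⟨k, hk⟩ : (p : ℤ) ∣ q := by
      exact_mod_cast hqp ▸ dvd_pow_self p hm.ne'
    rw [hk, show 2 - 2 * (p * k) = 2 + p * (-2 * k) by ring]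
    exact hp2.add_mul_left_left _
end

section
/- Let q be an odd prime power such that f(t) = t^4 + (2 − 2q) t^2 + q^2 is irreducible over Q, and let K = Q[t]/(f(t)) with ring of integers O. Then 2 is totally ramified in K: 2·O = 𝔓^4 for a maximal ideal 𝔓 of O whose residue field O/𝔓 has 2 elements. -/
open Polynomial NumberField

/-- If a prime `P` of `𝓞 K` contains the rational prime `p`, and `s ^ [K : ℚ] = p * u` with `u ∉ P`,
then `p` is totally ramified at `P`. -/
theorem NumberField.totallyRamified_of_pow_eq_mul {K : Type*} [Field K] [NumberField K]
    {p : ℕ} (hp : p.Prime) {P : Ideal (𝓞 K)} [P.IsPrime] (hpP : (p : 𝓞 K) ∈ P) {s u : 𝓞 K}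
    (hs : s ^ Module.finrank ℚ K = p * u) (hu : u ∉ P) :
    Ideal.span {(p : 𝓞 K)} = P ^ Module.finrank ℚ K ∧ Ideal.absNorm P = p := by
  have hn : Module.finrank ℚ K ≠ 0 := Module.finrank_pos.ne'
  have hsP : s ∈ P := Ideal.IsPrime.mem_of_pow_mem ‹_› _ (hs ▸ P.mul_mem_right u hpP)
  have hup : u * p ∈ P ^ Module.finrank ℚ K := by
    rw [mul_comm, ← hs]
    exact Ideal.pow_mem_pow hsP _
  have hpn := (Ideal.IsPrime.mul_mem_pow P hup).resolve_left hu
  obtain ⟨J, hJ⟩ := Ideal.dvd_iff_le.mpr ((Ideal.span_singleton_le_iff_mem _).mpr hpn)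
  have hnorm : Ideal.absNorm (Ideal.span {(p : 𝓞 K)}) = p ^ Module.finrank ℚ K := by
    rw [Ideal.absNorm_span_natCast, RingOfIntegers.rank]
  have hmul : Ideal.absNorm P ^ Module.finrank ℚ K * Ideal.absNorm J =
      p ^ Module.finrank ℚ K := by
    rw [← hnorm, hJ, map_mul, map_pow]
  have hP1 : Ideal.absNorm P ≠ 1 := fun h =>
    Ideal.IsPrime.ne_top ‹_› (Ideal.absNorm_eq_one_iff.mp h)
  have hPp : p ∣ Ideal.absNorm P := by
    obtain ⟨j, -, hj⟩ := (Nat.dvd_prime_pow hp).mp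
      ((dvd_pow_self _ hn).trans (Dvd.intro _ hmul))
    rw [hj] at hP1 ⊢
    exact dvd_pow_self p (by rintro rfl; simp at hP1)
  have hPeq : Ideal.absNorm P = p :=
    Nat.dvd_antisymm ((Nat.pow_dvd_pow_iff hn).mp (Dvd.intro _ hmul)) hPp
  have hJ1 : Ideal.absNorm J = 1 := by
    rw [hPeq] at hmul
    exact Nat.eq_of_mul_eq_mul_left (pow_pos hp.pos _) (by rw [hmul, mul_one])
  rw [Ideal.absNorm_eq_one_iff] at hJ1
  exact ⟨by rw [hJ, hJ1, Ideal.mul_top], hPeq⟩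

/-- Let `q` be an odd prime power such that
`f(t) = t^4 + (2 − 2q) t^2 + q^2` is irreducible over `ℚ`, and let `K = ℚ[t]/(f)` with
ring of integers `O`. Then `2` is totally ramified in `K`: `2·O = 𝔓^4` for a maximal
ideal `𝔓` of `O` whose residue field has `2` elements. -/
theorem statement7 (q p m : ℕ) (hp : p.Prime) (hq : q = p ^ m) (hm : 0 < m) (hodd : Odd q)
    (f : Polynomial ℤ)
    (hfdef : f = X ^ 4 + C (2 - 2 * (q : ℤ)) * X ^ 2 + C ((q : ℤ) ^ 2))
    (hirr : Irreducible (f.map (Int.castRingHom ℚ)))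
    (K : Type*) [Field K] [NumberField K] (π : K)
    (hroot : Polynomial.aeval π f = 0)
    (hgen : Algebra.adjoin ℚ {π} = ⊤) :
    ∃ 𝔓 : Ideal (𝓞 K), 𝔓.IsMaximal ∧ Ideal.span {(2 : 𝓞 K)} = 𝔓 ^ 4 ∧
      Nat.card (𝓞 K ⧸ 𝔓) = 2 := by
  have hmonic : f.Monic := by rw [hfdef]; monicity!
  have hdeg : f.natDegree = 4 := by rw [hfdef]; compute_degree!
  have hrank : Module.finrank ℚ K = 4 := by
    have hmin : f.map (Int.castRingHom ℚ) = minpoly ℚ π :=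
      minpoly.eq_of_irreducible_of_monic hirr
        (by rw [← hroot]; exact aeval_map_algebraMap ℚ π f) (hmonic.map _)
    have htop : IntermediateField.adjoin ℚ {π} = ⊤ := by
      rw [eq_top_iff, ← IntermediateField.toSubalgebra_le_toSubalgebra]
      exact hgen.ge.trans (IntermediateField.algebra_adjoin_le_adjoin ℚ {π})
    rw [← IntermediateField.finrank_top', ← htop,
      IntermediateField.adjoin.finrank (Algebra.IsIntegral.isIntegral π), ← hmin,
      hmonic.natDegree_map, hdeg]
  obtain ⟨k, hk⟩ := hodd
  obtain ⟨x, hxπ⟩ : ∃ x : 𝓞 K, algebraMap (𝓞 K) K x = π := ⟨⟨π, f, hmonic, hroot⟩, rfl⟩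
  have hx : x ^ 4 - 4 * k * x ^ 2 + (2 * k + 1) ^ 2 = 0 := by
    apply RingOfIntegers.ext
    have h := hroot
    rw [hfdef, hk] at h
    simp only [map_add, map_mul, map_pow, map_sub, map_ofNat, map_natCast, map_one,
      map_zero, aeval_X, hxπ] at h ⊢
    push_cast at h
    linear_combination h
  have h2 : ¬ IsUnit (2 : 𝓞 K) := by
    intro h
    have := (Ideal.absNorm_eq_one_iff (S := 𝓞 K)).mpr (Ideal.span_singleton_eq_top.mpr h)
    rw [show (2 : 𝓞 K) = ((2 : ℕ) : 𝓞 K) by norm_num, Ideal.absNorm_span_natCast,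
      RingOfIntegers.rank, hrank] at this
    norm_num at this
  obtain ⟨P, hP, h2P⟩ := exists_max_ideal_of_mem_nonunits h2
  set g : 𝓞 K := -2 * (x + 1) ^ 2 + 3 * (x + 1) - 2 - 2 * k * (x + 1) + 4 * k with hg
  have hs : (x + 1) ^ Module.finrank ℚ K =
      ((2 : ℕ) : 𝓞 K) * -(1 + (x + 1) * g + 2 * k ^ 2) := by
    rw [hrank, hg]
    push_cast
    linear_combination hx
  have hsP : x + 1 ∈ P := hP.isPrime.mem_of_pow_mem _
    (hs ▸ P.mul_mem_right _ (by exact_mod_cast h2P))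
  have hu : -(1 + (x + 1) * g + 2 * k ^ 2) ∉ P := fun h => by
    refine P.ne_top_iff_one.mp hP.ne_top ?_
    have := P.add_mem (P.add_mem h (P.mul_mem_right g hsP)) (P.mul_mem_right ((k : 𝓞 K) ^ 2) h2P)
    rw [← P.neg_mem_iff]
    convert this using 1
    ring
  obtain ⟨hspan, hnorm⟩ := NumberField.totallyRamified_of_pow_eq_mul Nat.prime_two
    (by exact_mod_cast h2P) hs hu
  refine ⟨P, hP, ?_, hnorm⟩
  rw [← hrank, ← hspan, Nat.cast_ofNat]
end

section
/- Let f(t) be a polynomial in P_A and set K = Q[t]/(f(t)). Then K contains a primitive cube root of unity; that is, there exists x ∈ K with x^2 + x + 1 = 0, so Q(ζ_3) embeds into K. -/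
open Polynomial NumberField

/-- If `π` is a nonzero root of `t^4 + a t^3 + (a^2 - q) t^2 + a q t + q^2`, with `q ≠ a^2` and
`4 q ≠ a^2`, then the field contains a square root of `-3`, namely
`(2 α + a) (β + (a^2 - q) / β) / (4 q - a^2)` with `α = π + q / π` and `β = π - q / π`. -/
theorem exists_sq_eq_neg_three_of_quartic_root {K : Type*} [Field K] {a q π : K} (hπ : π ≠ 0)
    (hb : a ^ 2 - q ≠ 0) (hd : 4 * q - a ^ 2 ≠ 0)
    (h : π ^ 4 + a * π ^ 3 + (a ^ 2 - q) * π ^ 2 + a * q * π + q ^ 2 = 0) :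
    ∃ s : K, s ^ 2 = -3 := by
  obtain ⟨r, hr⟩ : ∃ r : K, π * r = q := ⟨q / π, mul_div_cancel₀ q hπ⟩
  have hα : (π + r) ^ 2 + a * (π + r) + a ^ 2 - 3 * q = 0 := by
    have : π ^ 2 * ((π + r) ^ 2 + a * (π + r) + a ^ 2 - 3 * q) = 0 := by
      subst hr
      linear_combination h
    exact (mul_eq_zero.mp this).resolve_left (pow_ne_zero 2 hπ)
  have hβ : (π - r) ^ 2 = -(a * (π + r) + a ^ 2 + q) := by
    linear_combination hα - 4 * hr
  have hprod : (a * (π + r) - q) * (π - r) ^ 2 = (a ^ 2 - q) ^ 2 := by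
    rw [hβ]
    linear_combination -a ^ 2 * hα
  have hβ0 : π - r ≠ 0 := by
    intro h0
    rw [h0] at hprod
    exact pow_ne_zero 2 hb (by linear_combination -hprod)
  have hγ : ((a ^ 2 - q) / (π - r)) ^ 2 = a * (π + r) - q := by
    rw [div_pow, ← hprod, mul_div_cancel_right₀ _ (pow_ne_zero 2 hβ0)]
  have hβγ : (π - r) * ((a ^ 2 - q) / (π - r)) = a ^ 2 - q := mul_div_cancel₀ _ hβ0
  have hsum : (π - r + (a ^ 2 - q) / (π - r)) ^ 2 = a ^ 2 - 4 * q := by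
    linear_combination hβ + hγ + 2 * hβγ
  have hdisc : (2 * (π + r) + a) ^ 2 = 3 * (4 * q - a ^ 2) := by
    linear_combination 4 * hα
  refine ⟨(2 * (π + r) + a) * (π - r + (a ^ 2 - q) / (π - r)) / (4 * q - a ^ 2), ?_⟩
  rw [div_pow, mul_pow, hsum, hdisc, div_eq_iff (pow_ne_zero 2 hd)]
  ring

/-- Let `f ∈ P_A` and `K = ℚ[t]/(f)`. Then `K` contains a primitive cube
root of unity: there exists `x ∈ K` with `x^2 + x + 1 = 0`, so `ℚ(ζ₃)` embeds into `K`. -/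
theorem statement9 (q p m : ℕ) (a b : ℤ) (hf : inPA q p m a b)
    (K : Type*) [Field K] [Algebra ℚ K] (π : K)
    (hroot : Polynomial.aeval π (weilPoly q a b) = 0)
    (hgen : Algebra.adjoin ℚ {π} = ⊤) :
    ∃ x : K, x ^ 2 + x + 1 = 0 := by
  obtain ⟨hp, rfl, -, -, rfl, hneg, -⟩ := hf
  have : CharZero K := algebraRat.charZero K
  have hq : ((p ^ m : ℕ) : K) ≠ 0 := Nat.cast_ne_zero.mpr (pow_ne_zero m hp.ne_zero)
  generalize p ^ m = q at *
  have hroot' : π ^ 4 + (a : K) * π ^ 3 + ((a : K) ^ 2 - q) * π ^ 2 + a * q * π + (q : K) ^ 2 = 0 := by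
    simpa [weilPoly] using hroot
  have hπ : π ≠ 0 := by
    rintro rfl
    exact pow_ne_zero 2 hq (by linear_combination hroot')
  have hb : (a : K) ^ 2 - q ≠ 0 := mod_cast hneg.ne
  have hd : 4 * (q : K) - (a : K) ^ 2 ≠ 0 := by
    have : 4 * (q : ℤ) - a ^ 2 ≠ 0 := by nlinarith [sq_nonneg a]
    exact mod_cast this
  obtain ⟨s, hs⟩ := exists_sq_eq_neg_three_of_quartic_root hπ hb hd hroot'
  exact ⟨(-1 + s) / 2, by linear_combination hs / 4⟩
end

section
/- Let f(t) be a polynomial in P_A ∪ P_B, let K = Q[t]/(f(t)) with ring of integers O. Then 2 is neither inert nor totally split in K: the ideal 2·O is not a prime ideal of O, and 2·O is not the product of four pairwise distinct maximal ideals of O. -/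
open Polynomial NumberField

section Decomposition

variable {K : Type*} [Field K]

lemma splits_map_minpoly_of_sq_eq [Algebra ℚ K] {u : K} {c d : ℚ}
    (hu : u ^ 2 = algebraMap ℚ K c * u + algebraMap ℚ K d) :
    IsIntegral ℚ u ∧ ((minpoly ℚ u).map (algebraMap ℚ K)).Splits := by
  have hmonic : (X ^ 2 - (C c * X + C d) : ℚ[X]).Monic :=
    monic_X_pow_sub (by compute_degree; norm_num)
  have hroot : aeval u (X ^ 2 - (C c * X + C d) : ℚ[X]) = 0 := by
    simp [hu]
  refine ⟨⟨_, hmonic, hroot⟩, ?_⟩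
  have hfactor : (X ^ 2 - (C c * X + C d) : ℚ[X]).map (algebraMap ℚ K) =
      (X - C u) * (X - C (algebraMap ℚ K c - u)) := by
    have hd : algebraMap ℚ K d = u ^ 2 - algebraMap ℚ K c * u := by rw [hu]; ring
    simp only [Polynomial.map_sub, Polynomial.map_pow, Polynomial.map_add, Polynomial.map_mul,
      map_X, map_C, hd, C_sub, C_pow, C_mul]
    ring
  refine Splits.of_dvd (g := (X - C u) * (X - C (algebraMap ℚ K c - u)))
    ((Splits.X_sub_C _).mul (Splits.X_sub_C _)) ?_ ?_
  · exact mul_ne_zero (X_sub_C_ne_zero _) (X_sub_C_ne_zero _)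
  · rw [← hfactor]
    exact Polynomial.map_dvd _ (minpoly.dvd ℚ u hroot)

lemma apply_apply_of_sq_eq [Algebra ℚ K] (σ : K ≃ₐ[ℚ] K) {u : K} {c d : ℚ}
    (hu : u ^ 2 = algebraMap ℚ K c * u + algebraMap ℚ K d) : σ (σ u) = u := by
  have h : ∀ x : K, x ^ 2 = algebraMap ℚ K c * x + algebraMap ℚ K d →
      x = u ∨ x = algebraMap ℚ K c - u := fun x hx ↦ by
    have : (x - u) * (x - (algebraMap ℚ K c - u)) = 0 := by linear_combination hx - hu
    simpa [sub_eq_zero] using this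
  have hσ : (σ u) ^ 2 = algebraMap ℚ K c * σ u + algebraMap ℚ K d := by
    simpa using congrArg σ hu
  rcases h _ hσ with h | h
  · rw [h, h]
  · rw [h, map_sub, h, AlgEquiv.commutes]
    ring

variable [NumberField K]

lemma absNorm_span_two (hdeg : Module.finrank ℚ K = 4) :
    Ideal.absNorm (Ideal.span {(2 : 𝓞 K)}) = 16 := by
  have h : (2 : 𝓞 K) = algebraMap ℤ (𝓞 K) 2 := by simp
  rw [Ideal.absNorm_span_singleton, h, Algebra.norm_algebraMap, RingOfIntegers.rank, hdeg]
  norm_num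

/-- In a quartic number field generated by two quadratic elements, `2` is not inert. -/
lemma not_isPrime_span_two (hdeg : Module.finrank ℚ K = 4) {u v : K} {c d e g : ℚ}
    (hu : u ^ 2 = algebraMap ℚ K c * u + algebraMap ℚ K d)
    (hv : v ^ 2 = algebraMap ℚ K e * v + algebraMap ℚ K g)
    (hgen : Algebra.adjoin ℚ {u, v} = ⊤) :
    ¬ (Ideal.span {(2 : 𝓞 K)}).IsPrime := by
  intro hprime
  have hnormal : Normal ℚ K := by
    refine normal_iff.mpr fun x ↦ ⟨Algebra.IsIntegral.isIntegral x, ?_⟩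
    refine IntermediateField.splits_of_mem_adjoin ℚ K (S := {u, v}) ?_ ?_
    · rintro y (rfl | rfl)
      · exact splits_map_minpoly_of_sq_eq hu
      · exact splits_map_minpoly_of_sq_eq hv
    · rw [IntermediateField.adjoin_eq_top_iff.mpr hgen]
      trivial
  have : IsGalois ℚ K := ⟨⟩
  have hinv (σ : K ≃ₐ[ℚ] K) (x : K) : σ (σ x) = x := by
    have : (σ.toAlgHom.comp σ.toAlgHom) = AlgHom.id ℚ K := by
      refine AlgHom.ext_of_adjoin_eq_top hgen ?_
      rintro y (rfl | rfl)
      · exact apply_apply_of_sq_eq σ hu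
      · exact apply_apply_of_sq_eq σ hv
    exact DFunLike.congr_fun this x
  set Q : Ideal (𝓞 K) := Ideal.span {2} with hQ
  have hcard : Nat.card (𝓞 K ⧸ Q) = 16 := absNorm_span_two hdeg
  have hfin : Finite (𝓞 K ⧸ Q) := Nat.finite_of_card_ne_zero (by omega)
  have : Algebra.IsInvariant ℤ (𝓞 K) (K ≃ₐ[ℚ] K) := IsGaloisGroup.isInvariant
  obtain ⟨σ, hσ⟩ := IsArithFrobAt.exists_of_isInvariant ℤ (K ≃ₐ[ℚ] K) Q
  have hunder : Q.under ℤ = Ideal.span {2} := by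
    have hmax : (Ideal.span {(2 : ℤ)}).IsMaximal :=
      PrincipalIdealRing.isMaximal_of_irreducible Int.prime_two.irreducible
    refine (hmax.eq_of_le (Ideal.IsPrime.under ℤ Q).ne_top ?_).symm
    rw [Ideal.span_singleton_le_iff_mem, Ideal.mem_comap]
    rw [map_ofNat, hQ]
    exact Ideal.mem_span_singleton_self (2 : 𝓞 K)
  have hfrob (x : 𝓞 K) : σ • x - x ^ 2 ∈ Q := by
    have := hσ x
    rw [hunder, ← Nat.cast_ofNat, Int.card_ideal_quot] at this
    exact this
  have hpow (x : 𝓞 K ⧸ Q) : x ^ 4 = x := by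
    obtain ⟨x, rfl⟩ := Ideal.Quotient.mk_surjective x
    have h₁ := Ideal.Quotient.eq.mpr (hfrob x)
    have h₂ := Ideal.Quotient.eq.mpr (hfrob (σ • x))
    have h₃ : σ • σ • x = x := by
      ext
      exact hinv σ x
    rw [h₃, map_pow, h₁, map_pow, ← pow_mul] at h₂
    exact h₂.symm
  have : Fintype (𝓞 K ⧸ Q) := Fintype.ofFinite _
  have : Q.IsMaximal := Ideal.Quotient.maximal_of_isField _ (Finite.isField_of_domain (𝓞 K ⧸ Q))
  let : Field (𝓞 K ⧸ Q) := Ideal.Quotient.field Q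
  have hunits := (FiniteField.forall_pow_eq_one_iff (𝓞 K ⧸ Q) 3).mp fun x ↦ by
    refine Units.ext (mul_right_cancel₀ x.ne_zero ?_)
    rw [Units.val_pow_eq_pow_val, ← pow_succ, hpow, Units.val_one, one_mul]
  rw [← Nat.card_eq_fintype_card, hcard] at hunits
  omega

variable (K) in
/-- The ideal generated by `2` is a product of four distinct maximal ideals of `𝓞 K`. -/
def IsTotallySplitTwo : Prop :=
  ∃ P₁ P₂ P₃ P₄ : Ideal (𝓞 K),
    P₁.IsMaximal ∧ P₂.IsMaximal ∧ P₃.IsMaximal ∧ P₄.IsMaximal ∧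
    P₁ ≠ P₂ ∧ P₁ ≠ P₃ ∧ P₁ ≠ P₄ ∧ P₂ ≠ P₃ ∧ P₂ ≠ P₄ ∧ P₃ ≠ P₄ ∧
    Ideal.span {(2 : 𝓞 K)} = P₁ * P₂ * P₃ * P₄

lemma sq_sub_self_mem_of_absNorm_eq_two {P : Ideal (𝓞 K)} [P.IsMaximal]
    (h : Ideal.absNorm P = 2) (x : 𝓞 K) : x ^ 2 - x ∈ P := by
  have hcard : Nat.card (𝓞 K ⧸ P) = 2 := h
  have : Finite (𝓞 K ⧸ P) := Nat.finite_of_card_ne_zero (by omega)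
  have : Fintype (𝓞 K ⧸ P) := Fintype.ofFinite _
  let : Field (𝓞 K ⧸ P) := Ideal.Quotient.field P
  have := FiniteField.pow_card (Ideal.Quotient.mk P x)
  rw [← Nat.card_eq_fintype_card, hcard, ← map_pow] at this
  exact Ideal.Quotient.eq.mp this

/-- If `2` splits totally, then all residue fields above `2` are `𝔽₂`. -/
lemma IsTotallySplitTwo.two_dvd_sq_sub_self (hdeg : Module.finrank ℚ K = 4)
    (h : IsTotallySplitTwo K) (x : 𝓞 K) : (2 : 𝓞 K) ∣ x ^ 2 - x := by
  obtain ⟨P₁, P₂, P₃, P₄, h₁, h₂, h₃, h₄, h₁₂, h₁₃, h₁₄, h₂₃, h₂₄, h₃₄, hprod⟩ := h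
  have hnorm := absNorm_span_two hdeg
  rw [hprod, map_mul, map_mul, map_mul] at hnorm
  have hge (P : Ideal (𝓞 K)) (hP : P.IsMaximal) (h0 : Ideal.absNorm P ≠ 0) :
      2 ≤ Ideal.absNorm P := by
    have := mt Ideal.absNorm_eq_one_iff.mp hP.ne_top
    omega
  have hn₁ := hge P₁ h₁ (by rintro h; simp [h] at hnorm)
  have hn₂ := hge P₂ h₂ (by rintro h; simp [h] at hnorm)
  have hn₃ := hge P₃ h₃ (by rintro h; simp [h] at hnorm)
  have hn₄ := hge P₄ h₄ (by rintro h; simp [h] at hnorm)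
  have key {k l m n : ℕ} (hk : 2 ≤ k) (hl : 2 ≤ l) (hm : 2 ≤ m) (hn : 2 ≤ n)
      (h : k * l * m * n = 16) : k = 2 := by
    have : 2 * 2 * 2 ≤ l * m * n := by gcongr
    nlinarith
  have e₁ := key hn₁ hn₂ hn₃ hn₄ hnorm
  have e₂ := key hn₂ hn₁ hn₃ hn₄ (by linarith)
  have e₃ := key hn₃ hn₁ hn₂ hn₄ (by linarith)
  have e₄ := key hn₄ hn₁ hn₂ hn₃ (by linarith)
  have c₁₂ := Ideal.isCoprime_of_isMaximal h₁₂
  have c₁₃ := Ideal.isCoprime_of_isMaximal h₁₃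
  have c₁₄ := Ideal.isCoprime_of_isMaximal h₁₄
  have c₂₃ := Ideal.isCoprime_of_isMaximal h₂₃
  have c₂₄ := Ideal.isCoprime_of_isMaximal h₂₄
  have c₃₄ := Ideal.isCoprime_of_isMaximal h₃₄
  rw [← Ideal.mem_span_singleton, hprod,
    Ideal.mul_eq_inf_of_isCoprime ((c₁₄.mul_left c₂₄).mul_left c₃₄),
    Ideal.mul_eq_inf_of_isCoprime (c₁₃.mul_left c₂₃), Ideal.mul_eq_inf_of_isCoprime c₁₂]
  exact ⟨⟨⟨sq_sub_self_mem_of_absNorm_eq_two e₁ x, sq_sub_self_mem_of_absNorm_eq_two e₂ x⟩,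
    sq_sub_self_mem_of_absNorm_eq_two e₃ x⟩, sq_sub_self_mem_of_absNorm_eq_two e₄ x⟩

/-- If a quartic number field contains `√-1`, `√-2` or a primitive cube root of unity,
then `2` does not split totally in it. -/
lemma not_isTotallySplitTwo (hdeg : Module.finrank ℚ K = 4)
    (h : ∃ r : K, r ^ 2 = -1 ∨ r ^ 2 = -2 ∨ r ^ 2 + r + 1 = 0) : ¬ IsTotallySplitTwo K := by
  intro hsplit
  have hunit : ¬ (2 : 𝓞 K) ∣ 1 := fun hdvd ↦ by
    have h16 := absNorm_span_two hdeg
    rw [Ideal.span_singleton_eq_top.mpr (isUnit_of_dvd_one hdvd), Ideal.absNorm_top] at h16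
    omega
  have htwo : (2 : 𝓞 K) ≠ 0 := two_ne_zero
  obtain ⟨r, hr⟩ := h
  have hint : IsIntegral ℤ r := by
    rcases hr with hr | hr | hr
    · exact ⟨X ^ 2 + C 1, by monicity!, by simp [hr]⟩
    · exact ⟨X ^ 2 + C 2, by monicity!, by simp [hr]⟩
    · exact ⟨X ^ 2 + X + C 1, by monicity!, by simpa using hr⟩
  obtain ⟨R, rfl⟩ : ∃ R : 𝓞 K, algebraMap (𝓞 K) K R = r := ⟨⟨r, hint⟩, rfl⟩
  have hR : R ^ 2 = -1 ∨ R ^ 2 = -2 ∨ R ^ 2 + R + 1 = 0 :=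
    hr.imp (fun h ↦ by ext; simpa using h)
      (Or.imp (fun h ↦ by ext; simpa [map_ofNat] using h) fun h ↦ by ext; simpa using h)
  obtain ⟨s, hs⟩ := hsplit.two_dvd_sq_sub_self hdeg R
  apply hunit
  rcases hR with hR | hR | hR
  · refine ⟨-s - s ^ 2, mul_left_cancel₀ htwo ?_⟩
    have : R = -1 - 2 * s := by linear_combination hR - hs
    rw [this] at hR
    linear_combination hR
  · refine ⟨-(1 + s) ^ 2, mul_left_cancel₀ htwo ?_⟩
    have : R = -2 * (1 + s) := by linear_combination hR - hs
    rw [this] at hR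
    linear_combination hR
  · exact ⟨-s - R, by linear_combination hR - hs⟩

end Decomposition

section WeilPolynomial

variable {K : Type*} [Field K] {q : ℕ} {a b : ℤ}

lemma aeval_weilPoly (x : K) : aeval x (weilPoly q a b) =
    x ^ 4 + a * x ^ 3 + b * x ^ 2 + a * q * x + q ^ 2 := by
  simp [weilPoly]

variable (q a b) in
lemma monic_weilPoly : (weilPoly q a b).Monic := by
  unfold weilPoly
  monicity!

variable (q a b) in
lemma natDegree_weilPoly : (weilPoly q a b).natDegree = 4 := by
  unfold weilPoly
  compute_degree!

lemma natDegree_minpoly_of_irreducible_weilPoly [Algebra ℚ K] {x : K}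
    (hirr : Irreducible ((weilPoly q a b).map (Int.castRingHom ℚ)))
    (hroot : aeval x (weilPoly q a b) = 0) : (minpoly ℚ x).natDegree = 4 := by
  rw [← minpoly.eq_of_irreducible_of_monic hirr ?_ ((monic_weilPoly q a b).map _),
    (monic_weilPoly q a b).natDegree_map, natDegree_weilPoly]
  rw [← hroot]
  exact aeval_map_algebraMap ℚ x _

lemma finrank_eq_natDegree_minpoly [NumberField K] {x : K} (hgen : Algebra.adjoin ℚ {x} = ⊤) :
    Module.finrank ℚ K = (minpoly ℚ x).natDegree := by
  rw [← IntermediateField.adjoin.finrank (Algebra.IsIntegral.isIntegral x),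
    IntermediateField.adjoin_eq_top_iff.mpr hgen, IntermediateField.finrank_top']

lemma adjoin_pair_eq_top [Algebra ℚ K] {x u v : K} (hgen : Algebra.adjoin ℚ {x} = ⊤)
    (hx : ∀ S : Subalgebra ℚ K, u ∈ S → v ∈ S → x ∈ S) : Algebra.adjoin ℚ {u, v} = ⊤ := by
  rw [← top_le_iff, ← hgen]
  exact Algebra.adjoin_le (Set.singleton_subset_iff.mpr
    (hx _ (Algebra.subset_adjoin (by simp)) (Algebra.subset_adjoin (by simp))))

variable [NumberField K] {p m : ℕ} {x : K}

lemma inPA.two_not_inert_not_split (h : inPA q p m a b) (hroot : aeval x (weilPoly q a b) = 0)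
    (hgen : Algebra.adjoin ℚ {x} = ⊤) :
    ¬ (Ideal.span {(2 : 𝓞 K)}).IsPrime ∧ ¬ IsTotallySplitTwo K := by
  obtain ⟨hp, hq, -, hirr, hb, -⟩ := h
  have hmin := natDegree_minpoly_of_irreducible_weilPoly hirr hroot
  have hdeg := (finrank_eq_natDegree_minpoly hgen).trans hmin
  have hq0 : q ≠ 0 := hq ▸ pow_ne_zero _ hp.ne_zero
  have hden : (a * x + q : K) ≠ 0 := fun h0 ↦ by
    have hne : (C (a : ℚ) * X + C (q : ℚ)) ≠ 0 := fun h ↦ by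
      simpa [hq0] using congrArg (coeff · 0) h
    have hdvd := minpoly.dvd ℚ x (p := C (a : ℚ) * X + C (q : ℚ)) (by simpa using h0)
    have := (natDegree_le_of_dvd hdvd hne).trans natDegree_linear_le
    omega
  rw [aeval_weilPoly, hb] at hroot
  push_cast at hroot
  obtain ⟨w, hwden⟩ : ∃ w : K, w * (a * x + q) = x ^ 2 - q := ⟨_, div_mul_cancel₀ _ hden⟩
  have hw1 : w ^ 2 + w + 1 = 0 := by
    refine (mul_eq_zero.mp (?_ : (w ^ 2 + w + 1) * (a * x + q) ^ 2 = 0)).resolve_right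
      (pow_ne_zero 2 hden)
    linear_combination hroot + (w * (a * x + q) + (x ^ 2 - q) + (a * x + q)) * hwden
  have hw0 : w ≠ 0 := by rintro h; simp [h] at hw1
  have hs : (x / w) ^ 2 = a * (x / w) - q := by
    field_simp
    linear_combination -hwden + q * hw1
  refine ⟨not_isPrime_span_two (u := w) (v := x / w) (c := -1) (d := -1) (e := a) (g := -q)
    hdeg ?_ ?_ (adjoin_pair_eq_top hgen fun S huS hvS ↦ ?_),
    not_isTotallySplitTwo hdeg ⟨w, .inr (.inr hw1)⟩⟩
  · simp only [map_neg, map_one]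
    linear_combination hw1
  · simp only [map_neg, map_intCast, map_natCast]
    linear_combination hs
  · have h := S.mul_mem huS hvS
    rwa [mul_div_cancel₀ _ hw0] at h

lemma inPB.exists_sq_eq (h : inPB q p m b) {v : K} (hv : v ^ 2 = -2 * q - b)
    (hmin : (minpoly ℚ x).natDegree = 4) (hx : x ^ 4 + b * x ^ 2 + q ^ 2 = 0) :
    ∃ r : K, r ^ 2 = -1 ∨ r ^ 2 = -2 := by
  obtain ⟨hp, hq, -, -, hb⟩ := h
  have hq0 : (q : K) ≠ 0 := by exact_mod_cast hq ▸ pow_ne_zero _ hp.ne_zero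
  have hsq (hbq : b = -(q : ℤ)) (h : IsSquare q) : ∃ r : K, r ^ 2 = -1 ∨ r ^ 2 = -2 := by
    obtain ⟨n, rfl⟩ := h
    refine ⟨v / n, .inl ?_⟩
    subst hbq
    push_cast at hv hq0
    have hn : (n : K) ≠ 0 := left_ne_zero_of_mul hq0
    rw [div_pow, hv]
    field_simp
    ring
  have hexcl (n : ℕ) (h : x ^ 2 = n) : False := by
    have hdvd := minpoly.dvd ℚ x (p := X ^ 2 - C (n : ℚ)) (by simp [h])
    have := natDegree_le_of_dvd hdvd (X_pow_sub_C_ne_zero two_pos _)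
    rw [natDegree_X_pow_sub_C] at this
    omega
  rcases hb with rfl | ⟨rfl, -⟩ | ⟨hbq, ⟨-, h⟩ | ⟨-, h⟩ | ⟨rfl, h⟩⟩ | ⟨rfl, rfl⟩ | ⟨rfl, rfl⟩
  · exact ⟨v, .inl (by rw [hv]; push_cast; ring)⟩
  · exact ⟨v, .inr (by rw [hv]; push_cast; ring)⟩
  · exact hsq hbq h
  · exact hsq hbq h
  · have hodd : Odd m := by
      rw [← Nat.not_even_iff_odd]
      rintro ⟨k, rfl⟩
      exact h ⟨2 ^ k, by rw [hq, pow_add]⟩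
    obtain ⟨k, rfl⟩ := hodd
    refine ⟨v / 2 ^ k, .inr ?_⟩
    subst hbq
    rw [div_pow, hv, hq]
    push_cast
    field_simp
    ring
  · refine (hexcl 2 (sub_eq_zero.mp (pow_eq_zero_iff two_ne_zero |>.mp ?_))).elim
    push_cast at hx ⊢
    linear_combination hx
  · refine (hexcl 3 (sub_eq_zero.mp (pow_eq_zero_iff two_ne_zero |>.mp ?_))).elim
    push_cast at hx ⊢
    linear_combination hx

lemma inPB.two_not_inert_not_split (h : inPB q p m b) (hroot : aeval x (weilPoly q 0 b) = 0)
    (hgen : Algebra.adjoin ℚ {x} = ⊤) :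
    ¬ (Ideal.span {(2 : 𝓞 K)}).IsPrime ∧ ¬ IsTotallySplitTwo K := by
  have ⟨hp, hq, _, hirr, _⟩ := h
  have hmin := natDegree_minpoly_of_irreducible_weilPoly hirr hroot
  have hdeg := (finrank_eq_natDegree_minpoly hgen).trans hmin
  have hq0 : (q : K) ≠ 0 := by exact_mod_cast hq ▸ pow_ne_zero _ hp.ne_zero
  have hx : x ^ 4 + b * x ^ 2 + q ^ 2 = 0 := by simpa [aeval_weilPoly] using hroot
  have hx0 : x ≠ 0 := by rintro rfl; simp [hq0] at hx
  have hu : (x + q / x) ^ 2 = 2 * q - b := by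
    field_simp
    linear_combination hx
  have hv : (x - q / x) ^ 2 = -2 * q - b := by
    field_simp
    linear_combination hx
  refine ⟨not_isPrime_span_two (u := x + q / x) (v := x - q / x) (c := 0) (d := 2 * q - b)
    (e := 0) (g := -2 * q - b) hdeg (by simpa using hu) (by simpa using hv)
    (adjoin_pair_eq_top hgen fun S huS hvS ↦ ?_), not_isTotallySplitTwo hdeg ?_⟩
  · have h2 : (1 / 2 : ℚ) • ((x + q / x) + (x - q / x)) = x := by
      rw [Algebra.smul_def]
      simp
      ring
    exact h2 ▸ S.smul_mem (S.add_mem huS hvS) (1 / 2)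
  · obtain ⟨r, hr⟩ := h.exists_sq_eq hv hmin hx
    exact ⟨r, hr.imp_right .inl⟩

end WeilPolynomial

/-- Let `f ∈ P_A ∪ P_B` and `K = ℚ[t]/(f)` with ring of integers `O`.
Then `2` is neither inert nor totally split in `K`: `2·O` is not a prime ideal, and `2·O`
is not a product of four pairwise distinct maximal ideals. -/
theorem statement11 (q p m : ℕ) (a b : ℤ)
    (hf : inPA q p m a b ∨ (a = 0 ∧ inPB q p m b))
    (K : Type*) [Field K] [NumberField K] (π : K)
    (hroot : Polynomial.aeval π (weilPoly q a b) = 0)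
    (hgen : Algebra.adjoin ℚ {π} = ⊤) :
    ¬ (Ideal.span {(2 : 𝓞 K)}).IsPrime ∧
      ¬ ∃ P₁ P₂ P₃ P₄ : Ideal (𝓞 K),
        P₁.IsMaximal ∧ P₂.IsMaximal ∧ P₃.IsMaximal ∧ P₄.IsMaximal ∧
        P₁ ≠ P₂ ∧ P₁ ≠ P₃ ∧ P₁ ≠ P₄ ∧ P₂ ≠ P₃ ∧ P₂ ≠ P₄ ∧ P₃ ≠ P₄ ∧
        Ideal.span {(2 : 𝓞 K)} = P₁ * P₂ * P₃ * P₄ := by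
  rcases hf with hA | ⟨rfl, hB⟩
  · exact hA.two_not_inert_not_split hroot hgen
  · exact hB.two_not_inert_not_split hroot hgen
end

section
/- Let S be a commutative ring, σ : S → S a ring automorphism with σ ∘ σ = id, and 𝔐 a maximal ideal of S such that the quotient ring S/𝔐 is finite. Endow the abelian group D = Hom_Z(S/𝔐, Q/Z) with the S-module structure defined by (r·ψ)(m) = ψ(σ(r)·m) for r ∈ S, ψ ∈ D, m ∈ S/𝔐. Then D is isomorphic as an S-module to S/σ(𝔐). -/
/-- The embedding of `ℚ/ℤ` into the additive circle `ℝ/ℤ`. -/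
noncomputable def ratAddCircleToUnitAddCircle : AddCircle (1 : ℚ) →+ UnitAddCircle :=
  QuotientAddGroup.map _ _ (Rat.castHom ℝ).toAddMonoidHom (by
    rintro x hx
    obtain ⟨n, rfl⟩ := AddSubgroup.mem_zmultiples_iff.mp hx
    exact AddSubgroup.mem_zmultiples_iff.mpr ⟨n, by simp⟩)

theorem ratAddCircleToUnitAddCircle_injective :
    Function.Injective ratAddCircleToUnitAddCircle := by
  rw [injective_iff_map_eq_zero]
  intro x
  induction x using QuotientAddGroup.induction_on with
  | H q =>
    intro h
    have h' : (((q : ℝ)) : UnitAddCircle) = 0 := h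
    obtain ⟨n, hn⟩ := (AddCircle.coe_eq_zero_iff (1 : ℝ)).mp h'
    refine (AddCircle.coe_eq_zero_iff (1 : ℚ)).mpr ⟨n, ?_⟩
    have : ((n : ℚ) : ℝ) = (q : ℝ) := by simpa using hn
    simpa using Rat.cast_injective this

/-- The complex character attached to a `ℚ/ℤ`-valued one. -/
noncomputable def complexAddChar {A : Type*} [AddCommGroup A] (ψ : A →+ AddCircle (1 : ℚ)) :
    AddChar A ℂ where
  toFun a := (AddCircle.toCircle (ratAddCircleToUnitAddCircle (ψ a)) : ℂ)
  map_zero_eq_one' := by simp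
  map_add_eq_mul' a b := by simp [AddCircle.toCircle_add]

theorem complexAddChar_injective {A : Type*} [AddCommGroup A] :
    Function.Injective (complexAddChar (A := A)) := by
  intro ψ χ h
  ext a
  have ha : (AddCircle.toCircle (ratAddCircleToUnitAddCircle (ψ a)) : ℂ) =
      AddCircle.toCircle (ratAddCircleToUnitAddCircle (χ a)) := DFunLike.congr_fun h a
  exact ratAddCircleToUnitAddCircle_injective
    (AddCircle.injective_toCircle one_ne_zero (Subtype.ext ha))

theorem finite_addMonoidHom_ratAddCircle (A : Type*) [AddCommGroup A] [Finite A] :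
    Finite (A →+ AddCircle (1 : ℚ)) :=
  Finite.of_injective _ complexAddChar_injective

theorem card_addMonoidHom_ratAddCircle_le (A : Type*) [AddCommGroup A] [Finite A] :
    Nat.card (A →+ AddCircle (1 : ℚ)) ≤ Nat.card A := by
  have := Fintype.ofFinite A
  refine (Nat.card_le_card_of_injective _ complexAddChar_injective).trans ?_
  simpa only [Nat.card_eq_fintype_card] using AddChar.card_addChar_le A ℂ

/-- The dual of a finite field is a one-dimensional vector space over it. -/
theorem IsField.exists_addEquiv_addMonoidHom_ratAddCircle {K : Type*} [CommRing K] [Finite K]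
    (hK : IsField K) :
    ∃ e : (K →+ AddCircle (1 : ℚ)) ≃+ K,
      ∀ (b : K) (ψ : K →+ AddCircle (1 : ℚ)), e (ψ.comp (AddMonoidHom.mulLeft b)) = b * e ψ := by
  have := finite_addMonoidHom_ratAddCircle K
  have : Nontrivial K := hK.nontrivial
  obtain ⟨c, hc⟩ := CharacterModule.exists_character_apply_ne_zero_of_ne_zero (one_ne_zero (α := K))
  let ψ₀ : K →+ AddCircle (1 : ℚ) := c
  let f : K →+ (K →+ AddCircle (1 : ℚ)) :=
    { toFun := fun a => ψ₀.comp (AddMonoidHom.mulLeft a)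
      map_zero' := by ext; simp
      map_add' := fun a b => by ext; simp [add_mul] }
  have hf : Function.Injective f := by
    rw [injective_iff_map_eq_zero]
    intro a ha
    by_contra h
    obtain ⟨b, hb⟩ := hK.mul_inv_cancel h
    have hab : ψ₀ (a * b) = 0 := DFunLike.congr_fun ha b
    exact hc (by rwa [hb] at hab)
  have hbij := hf.bijective_of_nat_card_le (card_addMonoidHom_ratAddCircle_le K)
  let E := AddEquiv.ofBijective f hbij
  refine ⟨E.symm, fun b ψ => ?_⟩
  obtain ⟨a, rfl⟩ := E.surjective ψ
  rw [E.symm_apply_apply, E.symm_apply_eq]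
  ext x
  change ψ₀ (a * (b * x)) = ψ₀ (b * a * x)
  congr 1
  ring

/-- Let `S` be a commutative ring, `σ` a ring automorphism of `S` with
`σ ∘ σ = id`, and `𝔐` a maximal ideal of `S` with finite quotient. Then the Pontryagin
dual `D = Hom_ℤ(S/𝔐, ℚ/ℤ)`, with `S`-action `(r·ψ)(m) = ψ(σ(r)·m)`, is isomorphic as an
`S`-module to `S/σ(𝔐)`: there is an additive isomorphism intertwining the `S`-actions. -/
theorem statement13 (S : Type*) [CommRing S] (σ : S ≃+* S) (hσ : ∀ s : S, σ (σ s) = s)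
    (𝔐 : Ideal S) (h𝔐 : 𝔐.IsMaximal) (hfin : Finite (S ⧸ 𝔐)) :
    ∃ e : ((S ⧸ 𝔐) →+ AddCircle (1 : ℚ)) ≃+ (S ⧸ Ideal.map (σ : S →+* S) 𝔐),
      ∀ (r : S) (ψ : (S ⧸ 𝔐) →+ AddCircle (1 : ℚ)),
        e (ψ.comp (AddMonoidHom.mulLeft (Ideal.Quotient.mk 𝔐 (σ r)))) =
          Ideal.Quotient.mk (Ideal.map (σ : S →+* S) 𝔐) r * e ψ := by
  obtain ⟨e, he⟩ := IsField.exists_addEquiv_addMonoidHom_ratAddCircle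
    ((Ideal.Quotient.maximal_ideal_iff_isField_quotient 𝔐).mp h𝔐)
  let q := Ideal.quotientEquiv 𝔐 (Ideal.map (σ : S →+* S) 𝔐) σ rfl
  refine ⟨e.trans q.toAddEquiv, fun r ψ => ?_⟩
  change q (e _) = _ * q (e ψ)
  rw [he, map_mul, Ideal.quotientEquiv_mk, hσ]
end

section
/- The extension Q(ζ_3, √3)/Q(√3) is unramified at every finite prime: every maximal ideal of the ring of integers of Q(√3) is unramified in Q(ζ_3, √3). Likewise, the extension Q(ζ_3, √6)/Q(√6) is unramified at every finite prime. -/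
open NumberField

open Polynomial in
/-- If `x` generates `L / K` and is a root of `q` over `A`, then `q'(x)` lies in the different. -/
theorem aeval_derivative_mem_differentIdeal_of_root (A K L : Type*) {B : Type*}
    [CommRing A] [Field K] [CommRing B] [Field L] [Algebra A K] [Algebra B L] [Algebra A B]
    [Algebra K L] [Algebra A L] [IsScalarTower A K L] [IsScalarTower A B L] [IsDomain A]
    [IsFractionRing A K] [FiniteDimensional K L] [Algebra.IsSeparable K L]
    [IsIntegralClosure B A L] [IsIntegrallyClosed A] [IsDedekindDomain B]
    [Module.IsTorsionFree A B] [IsFractionRing B L] [Algebra.IsIntegral A B]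
    (x : B) (hx : Algebra.adjoin K {algebraMap B L x} = ⊤) (q : A[X]) (hq : aeval x q = 0) :
    aeval x (derivative q) ∈ differentIdeal A B := by
  obtain ⟨r, rfl⟩ := minpoly.isIntegrallyClosed_dvd (Algebra.IsIntegral.isIntegral x) hq
  simpa [derivative_mul] using
    Ideal.mul_mem_right (aeval x r) _ (aeval_derivative_mem_differentIdeal A K L x hx)

open Polynomial in
/-- If `x` generates `K / F` and `x ^ 2 + b x + c = 0` with `b` and `c` integral, then
`2 x + b` lies in the different. -/
theorem two_mul_add_mem_differentIdeal {F K : Type*} [Field F] [NumberField F] [Field K]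
    [NumberField K] [Algebra F K] (x : 𝓞 K) (hx : Algebra.adjoin F {(x : K)} = ⊤) (b c : 𝓞 F)
    (h : x ^ 2 + algebraMap (𝓞 F) (𝓞 K) b * x + algebraMap (𝓞 F) (𝓞 K) c = 0) :
    2 * x + algebraMap (𝓞 F) (𝓞 K) b ∈ differentIdeal (𝓞 F) (𝓞 K) := by
  convert aeval_derivative_mem_differentIdeal_of_root (𝓞 F) F K x hx
    (X ^ 2 + C b * X + C c) (by simpa using h) using 1
  simp [derivative_pow, map_ofNat (algebraMap (𝓞 F) (𝓞 K)) 2]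

theorem isIntegral_of_sq_eq_intCast {K : Type*} [Field K] [CharZero K] {w : K} {n : ℤ}
    (hw : w ^ 2 = n) : IsIntegral ℤ w :=
  .of_pow two_pos (hw ▸ isIntegral_algebraMap (R := ℤ) (x := n))

/-- The extensions `ℚ(ζ₃, √3)/ℚ(√3)` and `ℚ(ζ₃, √6)/ℚ(√6)` are
unramified at every finite prime: for `d ∈ {3, 6}`, if `F = ℚ(√d)` and `K = F(ζ₃)`, then
every maximal ideal of the ring of integers of `F` is unramified in `K`. -/
theorem statement16 (d : ℕ) (hd : d = 3 ∨ d = 6)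
    (F : Type*) [Field F] [NumberField F] (s : F) (hs : s ^ 2 = (d : F))
    (hFgen : Algebra.adjoin ℚ {s} = ⊤)
    (K : Type*) [Field K] [NumberField K] [Algebra F K]
    (z : K) (hz : z ^ 2 + z + 1 = 0) (hKgen : Algebra.adjoin F {z} = ⊤) :
    ∀ 𝔭 : Ideal (𝓞 F), 𝔭.IsMaximal → ∀ 𝔓 : Ideal (𝓞 K), 𝔓.IsMaximal →
      ¬ 𝔓 ^ 2 ∣ Ideal.map (algebraMap (𝓞 F) (𝓞 K)) 𝔭 := by
  intro 𝔭 h𝔭 𝔓 h𝔓 hdvd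
  have hle : differentIdeal (𝓞 F) (𝓞 K) ≤ 𝔓 := by
    simpa [Ideal.dvd_iff_le] using pow_sub_one_dvd_differentIdeal (𝓞 F) 𝔓 2
      (Ring.ne_bot_of_isMaximal_of_not_isField h𝔭 (RingOfIntegers.not_isField F)) hdvd
  have hd0 : d ≠ 0 := by rcases hd with rfl | rfl <;> norm_num
  have hs0 : s ≠ 0 := by
    rintro rfl
    exact hd0 (by exact_mod_cast (hs.symm.trans (zero_pow two_ne_zero)))
  have hsK : algebraMap F K s ^ 2 = d := by rw [← map_pow, hs, map_natCast]
  have hsK0 : algebraMap F K s ≠ 0 := by simpa using hs0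
  have hzint : IsIntegral ℤ z := .of_pow three_pos (by
    rw [show z ^ 3 = 1 by linear_combination (z - 1) * hz]; exact isIntegral_one)
  -- The discriminant `-3` of `X ^ 2 + X + 1` lies in `𝔓`.
  have h3 : (3 : 𝓞 K) ∈ 𝔓 := by
    obtain ⟨y, rfl⟩ : ∃ y : 𝓞 K, (y : K) = z := ⟨⟨z, hzint⟩, rfl⟩
    have hy : y ^ 2 + y + 1 = 0 := RingOfIntegers.ext (by simpa using hz)
    have hmem : 2 * y + 1 ∈ 𝔓 := hle (by
      simpa using two_mul_add_mem_differentIdeal (F := F) y hKgen 1 1 (by simpa using hy))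
    have := 𝔓.mul_mem_left (-(2 * y + 1)) hmem
    rwa [show -(2 * y + 1) * (2 * y + 1) = 3 by linear_combination -4 * hy] at this
  -- A scalar multiple of `√-3 / √d` is a square root of `-m` with `m` a power of two.
  obtain ⟨a, m, ha0, ham, hm⟩ :
      ∃ (a : ℚ) (m : ℕ), a ≠ 0 ∧ a ^ 2 * 3 = m * d ∧ (m = 1 ∨ m = 2) := by
    rcases hd with rfl | rfl
    · exact ⟨1, 1, by norm_num, by norm_num, .inl rfl⟩
    · exact ⟨2, 2, by norm_num, by norm_num, .inr rfl⟩
  have h4m : (4 * m : 𝓞 K) ∈ 𝔓 := by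
    let w : K := a * (2 * z + 1) / algebraMap F K s
    have hamK : (a : K) ^ 2 * 3 = m * d := by exact_mod_cast congrArg (Rat.cast : ℚ → K) ham
    have hw : w ^ 2 = ((-m : ℤ) : K) := by
      have : (d : K) ≠ 0 := by exact_mod_cast hd0
      simp only [w, div_pow, hsK]
      rw [div_eq_iff this]
      push_cast
      linear_combination 4 * (a : K) ^ 2 * hz - hamK
    have hwgen : Algebra.adjoin F {w} = ⊤ := by
      rw [eq_top_iff, ← hKgen, Algebra.adjoin_le_iff, Set.singleton_subset_iff]
      have hzw : z = algebraMap F K (s / (2 * a)) * w - algebraMap F K (1 / 2) := by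
        have : (a : K) ≠ 0 := by exact_mod_cast ha0
        simp only [w, map_div₀, map_mul, map_ofNat, map_ratCast, map_one]
        field_simp
        ring
      rw [SetLike.mem_coe, hzw]
      exact sub_mem (mul_mem (Subalgebra.algebraMap_mem _ _) (Algebra.self_mem_adjoin_singleton F w))
        (Subalgebra.algebraMap_mem _ _)
    obtain ⟨v, hvw⟩ : ∃ v : 𝓞 K, (v : K) = w := ⟨⟨w, isIntegral_of_sq_eq_intCast hw⟩, rfl⟩
    rw [← hvw] at hw hwgen
    have hv : v ^ 2 + m = 0 := RingOfIntegers.ext (by simp [hw])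
    have hmem : 2 * v ∈ 𝔓 := hle (by
      simpa using two_mul_add_mem_differentIdeal (F := F) v hwgen 0 m (by simpa using hv))
    have := 𝔓.mul_mem_left (-(2 * v)) hmem
    rwa [show -(2 * v) * (2 * v) = 4 * m by linear_combination -4 * hv] at this
  refine h𝔓.ne_top ((Ideal.eq_top_iff_one _).mpr ?_)
  rcases hm with rfl | rfl
  · convert sub_mem h4m h3 using 1
    norm_num
  · convert sub_mem (𝔓.mul_mem_left 3 h3) h4m using 1
    norm_num
end

section
/- Let q be a prime power and b an integer such that f(t) = t^4 + b t^2 + q^2 is irreducible over Q. Let K = Q[t]/(f(t)) with π the class of t, let K^+ = Q(π + q/π) be its quadratic subfield, and let O and O^+ be the rings of integers of K and K^+. Then the norm N_{K^+/Q}(Δ_{K/K^+}) of the relative discriminant ideal Δ_{K/K^+} ⊆ O^+ (the norm to O^+ of the different ideal of O over O^+) divides (2q + b)^2. -/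
open Polynomial NumberField

/-- A subset generating an algebra over a ring generates it over any larger ring. -/
theorem adjoin_eq_top_of_isScalarTower {R A : Type*} (S : Type*) [CommSemiring R] [CommSemiring S]
    [Semiring A] [Algebra R S] [Algebra R A] [Algebra S A] [IsScalarTower R S A] {s : Set A}
    (hs : Algebra.adjoin R s = ⊤) : Algebra.adjoin S s = ⊤ := by
  have hle : Algebra.adjoin R s ≤ (Algebra.adjoin S s).restrictScalars R :=
    Algebra.adjoin_le Algebra.subset_adjoin
  exact top_unique fun z _ ↦ hle (hs ▸ Algebra.mem_top)

/-- If `g` is any polynomial over `𝓞 F` killing a generator `x ∈ 𝓞 E` of `E / F`, then `g'(x)` lies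
in the different ideal. -/
theorem aeval_derivative_mem_differentIdeal_of_aeval_eq_zero {F E : Type*} [Field F] [NumberField F]
    [Field E] [NumberField E] [Algebra F E] (x : 𝓞 E)
    (hx : Algebra.adjoin F {algebraMap (𝓞 E) E x} = ⊤) {g : Polynomial (𝓞 F)}
    (hg : aeval x g = 0) :
    aeval x (derivative g) ∈ differentIdeal (𝓞 F) (𝓞 E) := by
  obtain ⟨h, rfl⟩ := minpoly.isIntegrallyClosed_dvd (Algebra.IsIntegral.isIntegral x) hg
  have hmem := aeval_derivative_mem_differentIdeal (𝓞 F) F E x hx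
  simpa [derivative_mul, minpoly.aeval] using Ideal.mul_mem_right (aeval x h) _ hmem

/-- The rational integer norm of an algebraic integer whose square is the rational integer `d`, in
a quartic field. -/
theorem norm_sq_eq_of_sq_eq_intCast {E : Type*} [Field E] [NumberField E]
    (hE : Module.finrank ℚ E = 4) {y : 𝓞 E} {d : ℤ} (hy : y ^ 2 = d) :
    Algebra.norm ℤ y ^ 2 = (d ^ 2) ^ 2 := by
  rw [← map_pow, hy, ← eq_intCast (algebraMap ℤ (𝓞 E)), Algebra.norm_algebraMap,
    RingOfIntegers.rank, hE]
  ring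

/-- The degree of a number field generated by a root of an irreducible rational polynomial. -/
theorem finrank_eq_natDegree_of_adjoin_eq_top {E : Type*} [Field E] [NumberField E] {x : E}
    {g : Polynomial ℚ} (hg : Irreducible g) (hx : aeval x g = 0)
    (hgen : Algebra.adjoin ℚ {x} = ⊤) : Module.finrank ℚ E = g.natDegree := by
  have hint : IsIntegral ℚ x := Algebra.IsIntegral.isIntegral x
  have htop : IntermediateField.adjoin ℚ {x} = ⊤ := by
    rw [← IntermediateField.toSubalgebra_inj,
      IntermediateField.adjoin_simple_toSubalgebra_of_isAlgebraic hint.isAlgebraic, hgen,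
      IntermediateField.top_toSubalgebra]
  rw [← IntermediateField.finrank_top', ← htop, IntermediateField.adjoin.finrank hint,
    ← minpoly.eq_of_irreducible hg hx,
    natDegree_mul_C (inv_ne_zero (leadingCoeff_ne_zero.mpr hg.ne_zero))]

/-- Let `q` be a prime power and `b` an integer with
`f(t) = t^4 + b t^2 + q^2` irreducible over `ℚ`. Let `K = ℚ[t]/(f)` with root `π`,
`K⁺ = ℚ(π + q/π)` its quadratic subfield, with rings of integers `O`, `O⁺`. Then
`N_{K⁺/ℚ}(Δ_{K/K⁺})` divides `(2q + b)^2`, where `Δ_{K/K⁺}` is the norm to `O⁺` of the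
different ideal of `O` over `O⁺`. Since the absolute norm is multiplicative in towers,
`N_{K⁺/ℚ}(Δ_{K/K⁺})` equals the absolute norm of the different ideal of `O/O⁺`. -/
theorem statement17 (q p m : ℕ) (b : ℤ) (hp : p.Prime) (hq : q = p ^ m) (hm : 0 < m)
    (f : Polynomial ℤ)
    (hfdef : f = X ^ 4 + C b * X ^ 2 + C ((q : ℤ) ^ 2))
    (hirr : Irreducible (f.map (Int.castRingHom ℚ)))
    (K : Type*) [Field K] [NumberField K] (π : K)
    (hroot : Polynomial.aeval π f = 0)
    (hgen : Algebra.adjoin ℚ {π} = ⊤)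
    (Kp : Type*) [Field Kp] [NumberField Kp] [Algebra Kp K] [IsScalarTower ℚ Kp K]
    (ρ : Kp) (hρ : algebraMap Kp K ρ = π + (q : K) / π)
    (hgenp : Algebra.adjoin ℚ {ρ} = ⊤) :
    (Ideal.absNorm (differentIdeal (𝓞 Kp) (𝓞 K)) : ℤ) ∣ (2 * (q : ℤ) + b) ^ 2 := by
  have hroot4 : π ^ 4 + (b : K) * π ^ 2 + (q : K) ^ 2 = 0 := by
    simpa [hfdef] using hroot
  have hq0 : (q : K) ≠ 0 := by
    rw [hq]
    exact_mod_cast (pow_pos hp.pos m).ne'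
  have hπ0 : π ≠ 0 := by
    rintro rfl
    simp [hq0] at hroot4
  have hrank : Module.finrank ℚ K = 4 := by
    rw [finrank_eq_natDegree_of_adjoin_eq_top hirr ?_ hgen, hfdef]
    · simp only [Polynomial.map_add, Polynomial.map_mul, Polynomial.map_pow, map_X, map_C]
      compute_degree!
    · rw [← hroot, ← algebraMap_int_eq, aeval_map_algebraMap]
  have hρsq : ρ ^ 2 = 2 * (q : Kp) - b := by
    apply (algebraMap Kp K).injective
    simp only [map_pow, map_sub, map_mul, map_natCast, map_intCast, map_ofNat, hρ]
    field_simp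
    linear_combination hroot4
  have hρint : IsIntegral ℤ ρ :=
    ⟨X ^ 2 - C (2 * (q : ℤ) - b), monic_X_pow_sub_C _ two_ne_zero, by
      rw [eval₂_sub, eval₂_X_pow, eval₂_C, hρsq]
      simp⟩
  have hπint : IsIntegral ℤ π := by
    refine ⟨f, ?_, hroot⟩
    rw [hfdef]
    monicity!
  let r : 𝓞 Kp := ⟨ρ, hρint⟩
  let x : 𝓞 K := ⟨π, hπint⟩
  have hr : algebraMap (𝓞 K) K (algebraMap (𝓞 Kp) (𝓞 K) r) = π + q / π := hρ
  have hx : algebraMap (𝓞 K) K x = π := rfl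
  have hxgen : Algebra.adjoin Kp {algebraMap (𝓞 K) K x} = ⊤ :=
    adjoin_eq_top_of_isScalarTower Kp hgen
  have hquad : aeval x (X ^ 2 - C r * X + C (q : 𝓞 Kp)) = 0 := by
    apply RingOfIntegers.coe_injective
    simp only [map_add, map_sub, map_mul, map_pow, aeval_X, aeval_C, hr, hx, map_natCast, map_zero]
    field_simp
    ring
  have hmem := aeval_derivative_mem_differentIdeal_of_aeval_eq_zero x hxgen hquad
  have hder : aeval x (derivative (X ^ 2 - C r * X + C (q : 𝓞 Kp))) =
      x + x - algebraMap (𝓞 Kp) (𝓞 K) r := by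
    simp [-map_natCast, add_mul]
  rw [hder] at hmem
  have hsq : (x + x - algebraMap (𝓞 Kp) (𝓞 K) r) ^ 2 =
      ((-(2 * (q : ℤ) + b) : ℤ) : 𝓞 K) := by
    apply RingOfIntegers.coe_injective
    simp only [map_pow, map_add, map_sub, map_intCast, hr, hx]
    push_cast
    field_simp
    linear_combination hroot4
  have hnorm := norm_sq_eq_of_sq_eq_intCast hrank hsq
  have hdvd := Ideal.absNorm_dvd_norm_of_mem hmem
  rw [neg_sq] at hnorm
  rcases sq_eq_sq_iff_eq_or_eq_neg.mp hnorm with h | h <;> rw [h] at hdvd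
  · exact hdvd
  · exact dvd_neg.mp hdvd
end
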